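/- Let p > 2 and q > p − 1 with q ≠ p, and define Ψ(z) := z + ((p−1)²/(2(2p−1))) · (1 + q − p) · λ₁^{p−2} · ∫₀^z s^{p−1}/(1 + (p − q)s) ds for z ≥ 0. Then for every 2π-periodic C¹ function u : ℝ → ℝ that is not identically zero, ‖u'‖_p² ≥ λ₁ · ‖u‖_q² · Ψ( (‖u‖_p² − ‖u‖_q²) / ((p − q) · ‖u‖_q²) ). (Improved interpolation inequality of Theorem 3.1; note the argument of Ψ is nonnegative.) -/

import Mathlib

open MeasureTheory Real

/-- The L^r norm on the circle with the uniform probability measure dσ = dx/(2π),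
for a 2π-periodic function `u : ℝ → ℝ`. -/
noncomputable def perNorm (r : ℝ) (u : ℝ → ℝ) : ℝ :=
  ((1 / (2 * π)) * ∫ x in (0:ℝ)..(2 * π), |u x| ^ r) ^ (1 / r)

/-- `u` is 2π-periodic and C¹. -/
def PeriodicC1 (u : ℝ → ℝ) : Prop :=
  Function.Periodic u (2 * π) ∧ ContDiff ℝ 1 u

/-- λ₁ = inf ‖v'‖_p²/‖v‖_p² over 2π-periodic C¹ functions v ≢ 0 with ∫₀^{2π} v dx = 0. -/
noncomputable def lambdaOne (p : ℝ) : ℝ :=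
  sInf { l : ℝ | ∃ v : ℝ → ℝ, PeriodicC1 v ∧ v ≠ 0 ∧
    (∫ x in (0:ℝ)..(2 * π), v x) = 0 ∧
    l = (perNorm p (deriv v)) ^ 2 / (perNorm p v) ^ 2 }

/-- λ₁* = inf ‖v'‖_p²/‖v‖_2² over 2π-periodic C¹ functions v ≢ 0 with ∫₀^{2π} v dx = 0. -/
noncomputable def lambdaOneStar (p : ℝ) : ℝ :=
  sInf { l : ℝ | ∃ v : ℝ → ℝ, PeriodicC1 v ∧ v ≠ 0 ∧
    (∫ x in (0:ℝ)..(2 * π), v x) = 0 ∧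
    l = (perNorm p (deriv v)) ^ 2 / (perNorm 2 v) ^ 2 }

/-- The p-Laplacian L_p u = (|u'|^{p-2} u')'. -/
noncomputable def pLap (p : ℝ) (u : ℝ → ℝ) : ℝ → ℝ :=
  deriv (fun x => |deriv u x| ^ (p - 2) * deriv u x)

/-- average over the circle -/
noncomputable def av (f : ℝ → ℝ) : ℝ := (1 / (2 * π)) * ∫ x in (0:ℝ)..(2 * π), f x

/-- odd power -/
noncomputable def psi (r x : ℝ) : ℝ := |x| ^ (r - 2) * x

lemma two_pi_pos' : (0:ℝ) < 2 * π := by positivity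

lemma av_add {f g : ℝ → ℝ} (hf : Continuous f) (hg : Continuous g) :
    av (fun x => f x + g x) = av f + av g := by
  unfold av
  rw [intervalIntegral.integral_add (hf.intervalIntegrable _ _) (hg.intervalIntegrable _ _)]
  ring

lemma av_sub {f g : ℝ → ℝ} (hf : Continuous f) (hg : Continuous g) :
    av (fun x => f x - g x) = av f - av g := by
  unfold av
  rw [intervalIntegral.integral_sub (hf.intervalIntegrable _ _) (hg.intervalIntegrable _ _)]
  ring

lemma av_cmul (c : ℝ) (f : ℝ → ℝ) : av (fun x => c * f x) = c * av f := by
  unfold av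
  rw [intervalIntegral.integral_const_mul]
  ring

lemma av_neg (f : ℝ → ℝ) : av (fun x => - f x) = - av f := by
  have := av_cmul (-1) f
  simpa using this

lemma av_const (c : ℝ) : av (fun _ => c) = c := by
  unfold av
  have := pi_pos.ne'
  rw [intervalIntegral.integral_const]
  simp
  field_simp

lemma av_mono {f g : ℝ → ℝ} (hf : Continuous f) (hg : Continuous g) (h : ∀ x, f x ≤ g x) :
    av f ≤ av g := by
  unfold av
  apply mul_le_mul_of_nonneg_left _ (by positivity)
  apply intervalIntegral.integral_mono two_pi_pos'.le (hf.intervalIntegrable _ _)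
    (hg.intervalIntegrable _ _) h

lemma av_nonneg {f : ℝ → ℝ} (h : ∀ x, 0 ≤ f x) : 0 ≤ av f := by
  unfold av
  apply mul_nonneg (by positivity)
  exact intervalIntegral.integral_nonneg two_pi_pos'.le (fun x _ => h x)

lemma av_pos {f : ℝ → ℝ} (hf : Continuous f) (hper : Function.Periodic f (2 * π))
    (h : ∀ x, 0 ≤ f x) {y : ℝ} (hy : f y ≠ 0) : 0 < av f := by
  unfold av
  apply mul_pos (by positivity)
  obtain ⟨z, hz, hzy⟩ := hper.exists_mem_Ico₀ two_pi_pos' y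
  refine intervalIntegral.integral_pos two_pi_pos' hf.continuousOn (fun x _ => h x)
    ⟨z, ⟨hz.1, hz.2.le⟩, ?_⟩
  rw [← hzy]
  exact lt_of_le_of_ne (h y) (Ne.symm hy)

lemma memLp_cont {f : ℝ → ℝ} (hf : Continuous f) (a : ENNReal) :
    MemLp f a (volume.restrict (Set.Ioc (0:ℝ) (2 * π))) := by
  obtain ⟨C, hC⟩ := (isCompact_Icc (a := (0:ℝ)) (b := 2 * π)).exists_bound_of_continuousOn
    hf.continuousOn
  refine MemLp.of_bound hf.aestronglyMeasurable C ?_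
  filter_upwards [ae_restrict_mem measurableSet_Ioc] with x hx
  exact hC x ⟨hx.1.le, hx.2⟩

lemma cont_abs_rpow {f : ℝ → ℝ} (hf : Continuous f) {r : ℝ} (hr : 0 ≤ r) :
    Continuous (fun x => |f x| ^ r) :=
  hf.abs.rpow_const (fun _ => Or.inr hr)

lemma av_holder {a b : ℝ} (hab : a.HolderConjugate b) {f g : ℝ → ℝ} (hf : Continuous f)
    (hg : Continuous g) (hf0 : ∀ x, 0 ≤ f x) (hg0 : ∀ x, 0 ≤ g x) :
    av (fun x => f x * g x) ≤ av (fun x => f x ^ a) ^ (1 / a) * av (fun x => g x ^ b) ^ (1 / b) := by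
  have h := integral_mul_le_Lp_mul_Lq_of_nonneg hab
    (μ := volume.restrict (Set.Ioc (0:ℝ) (2 * π))) (f := f) (g := g)
    (Filter.Eventually.of_forall hf0) (Filter.Eventually.of_forall hg0)
    (memLp_cont hf _) (memLp_cont hg _)
  unfold av
  simp only [intervalIntegral.integral_of_le two_pi_pos'.le]
  have e1 : 0 ≤ ∫ x in Set.Ioc (0:ℝ) (2 * π), f x ^ a :=
    integral_nonneg (fun x => rpow_nonneg (hf0 x) _)
  have e2 : 0 ≤ ∫ x in Set.Ioc (0:ℝ) (2 * π), g x ^ b :=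
    integral_nonneg (fun x => rpow_nonneg (hg0 x) _)
  rw [mul_rpow (by positivity) e1, mul_rpow (by positivity) e2]
  have e3 : (1 / (2 * π)) ^ (1 / a) * (1 / (2 * π)) ^ (1 / b) = 1 / (2 * π) := by
    rw [← rpow_add (by positivity)]
    have := hab.inv_add_inv_eq_one
    rw [one_div a, one_div b, this, rpow_one]
  calc _ ≤ 1 / (2 * π) * _ := mul_le_mul_of_nonneg_left h (by positivity)
    _ = _ := by
      nth_rw 1 [← e3]
      simp only [mul_comm, mul_left_comm, mul_assoc]

lemma av_cs {f g : ℝ → ℝ} (hf : Continuous f) (hg : Continuous g) :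
    av (fun x => f x * g x) ^ 2 ≤ av (fun x => f x ^ 2) * av (fun x => g x ^ 2) := by
  have h := av_holder (a := 2) (b := 2) Real.HolderConjugate.two_two hf.abs hg.abs
    (fun x => abs_nonneg _) (fun x => abs_nonneg _)
  have h1 : |av (fun x => f x * g x)| ≤ av (fun x => |f x| * |g x|) := by
    rw [abs_le]
    constructor
    · rw [← av_neg]
      apply av_mono (by fun_prop) (by fun_prop)
      intro x
      rw [← abs_mul]
      exact neg_abs_le _
    · apply av_mono (by fun_prop) (by fun_prop)
      intro x
      rw [← abs_mul]
      exact le_abs_self _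
  have h2 := h1.trans h
  simp only [rpow_two, sq_abs, ← sqrt_eq_rpow] at h2
  have e1 : 0 ≤ av (fun x => f x ^ 2) := av_nonneg (fun x => sq_nonneg _)
  have e2 : 0 ≤ av (fun x => g x ^ 2) := av_nonneg (fun x => sq_nonneg _)
  calc _ = |av (fun x => f x * g x)| ^ 2 := (sq_abs _).symm
    _ ≤ (√(av fun x => f x ^ 2) * √(av fun x => g x ^ 2)) ^ 2 := by
      gcongr
    _ = _ := by rw [mul_pow, sq_sqrt e1, sq_sqrt e2]

lemma av_power_mean {r s : ℝ} (hr : 0 < r) (hrs : r ≤ s) {f : ℝ → ℝ} (hf : Continuous f) :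
    av (fun x => |f x| ^ r) ^ (1 / r) ≤ av (fun x => |f x| ^ s) ^ (1 / s) := by
  rcases hrs.eq_or_lt with rfl | hlt
  · exact le_rfl
  have ha : 1 < s / r := by rwa [one_lt_div hr]
  have h := av_holder (Real.HolderConjugate.conjExponent ha) (cont_abs_rpow hf hr.le)
    (continuous_const (y := (1:ℝ))) (fun x => by positivity) (fun x => zero_le_one)
  simp only [mul_one, one_rpow, av_const] at h
  have e : ∀ x, (|f x| ^ r) ^ (s / r) = |f x| ^ s := by
    intro x
    rw [← rpow_mul (abs_nonneg _)]
    congr 1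
    field_simp
  simp only [e] at h
  calc _ ≤ (av (fun x => |f x| ^ s) ^ (1 / (s / r))) ^ (1 / r) := by
        apply rpow_le_rpow _ h (by positivity)
        exact av_nonneg (fun x => by positivity)
    _ = _ := by
        rw [← rpow_mul (av_nonneg (fun x => by positivity))]
        congr 1
        have := hr.trans hlt
        field_simp

lemma av_parts {f g f' g' : ℝ → ℝ} (hf : ∀ x, HasDerivAt f (f' x) x)
    (hg : ∀ x, HasDerivAt g (g' x) x) (hf' : Continuous f') (hg' : Continuous g')
    (h0 : f (2 * π) * g (2 * π) = f 0 * g 0) :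
    av (fun x => f x * g' x) = - av (fun x => f' x * g x) := by
  unfold av
  rw [intervalIntegral.integral_mul_deriv_eq_deriv_mul (fun x _ => hf x) (fun x _ => hg x)
    (hf'.intervalIntegrable _ _) (hg'.intervalIntegrable _ _), h0]
  ring

lemma av_tendsto {ι : Type*} {l : Filter ι} [l.IsCountablyGenerated] {F : ι → ℝ → ℝ} {f : ℝ → ℝ}
    (C : ℝ) (hF : ∀ᶠ n in l, Continuous (F n)) (hb : ∀ᶠ n in l, ∀ x ∈ Set.Icc (0:ℝ) (2*π), |F n x| ≤ C)
    (hlim : ∀ x, Filter.Tendsto (fun n => F n x) l (nhds (f x))) :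
    Filter.Tendsto (fun n => av (F n)) l (nhds (av f)) := by
  unfold av
  apply Filter.Tendsto.const_mul
  refine intervalIntegral.tendsto_integral_filter_of_dominated_convergence (fun _ => C) ?_ ?_ ?_ ?_
  · filter_upwards [hF] with n hn using hn.aestronglyMeasurable
  · filter_upwards [hb] with n hn
    refine Filter.Eventually.of_forall fun x hx => ?_
    rw [Set.uIoc_of_le two_pi_pos'.le] at hx
    exact hn x ⟨hx.1.le, hx.2⟩
  · exact intervalIntegrable_const
  · exact Filter.Eventually.of_forall fun x _ => hlim x

/-! odd powers -/

lemma psi_mul_self {r : ℝ} (hr : 1 < r) (x : ℝ) : psi r x * x = |x| ^ r := by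
  unfold psi
  rcases eq_or_ne x 0 with rfl | hx
  · simp [zero_rpow (by linarith : r ≠ 0)]
  · have : 0 < |x| := abs_pos.2 hx
    rw [mul_assoc, ← sq, ← sq_abs, ← rpow_natCast |x| 2, ← rpow_add this]
    norm_num

lemma abs_psi {r : ℝ} (hr : 1 < r) (x : ℝ) : |psi r x| = |x| ^ (r - 1) := by
  unfold psi
  rcases eq_or_ne x 0 with rfl | hx
  · simp [zero_rpow (by linarith : r - 1 ≠ 0)]
  · have : 0 < |x| := abs_pos.2 hx
    rw [abs_mul, abs_of_nonneg (by positivity)]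
    nth_rw 2 [← rpow_one |x|]
    rw [← rpow_add this]
    congr 1; ring

lemma psi_nonneg {r x : ℝ} (hx : 0 ≤ x) : 0 ≤ psi r x := by
  unfold psi; positivity

lemma psi_nonpos {r x : ℝ} (hx : x ≤ 0) : psi r x ≤ 0 := by
  unfold psi
  exact mul_nonpos_of_nonneg_of_nonpos (by positivity) hx

lemma psi_inv {r s : ℝ} (hrs : r.HolderConjugate s) (x : ℝ) : psi r (psi s x) = x := by
  have hs := hrs.symm.lt
  have h1 : (s - 1) * (r - 2) + (s - 2) = 0 := by
    have := hrs.mul_eq_add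
    linarith
  rcases eq_or_ne x 0 with rfl | hx
  · simp [psi]
  · have : 0 < |x| := abs_pos.2 hx
    rw [psi, abs_psi hs, ← rpow_mul this.le, psi, ← mul_assoc, ← rpow_add this, h1]
    simp

lemma continuous_psi {r : ℝ} (hr : 1 < r) : Continuous (psi r) := by
  rw [continuous_iff_continuousAt]
  intro x
  rcases eq_or_ne x 0 with rfl | hx
  · have h0 : psi r 0 = 0 := by simp [psi]
    rw [ContinuousAt, h0]
    have h1 : Filter.Tendsto (fun x : ℝ => |x| ^ (r - 1)) (nhds 0) (nhds 0) := by
      have : Continuous (fun x : ℝ => |x| ^ (r - 1)) := cont_abs_rpow continuous_id (by linarith)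
      have h2 := this.tendsto 0
      simpa [zero_rpow (by linarith : r - 1 ≠ 0)] using h2
    apply squeeze_zero_norm _ h1
    intro x
    rw [norm_eq_abs, abs_psi hr]
  · unfold psi
    apply ContinuousAt.mul _ continuousAt_id
    exact continuous_abs.continuousAt.rpow_const (Or.inl (abs_ne_zero.2 hx))

lemma hasDerivAt_abs_rpow' {r : ℝ} (hr : 1 < r) (x : ℝ) :
    HasDerivAt (fun x : ℝ => |x| ^ r) (r * psi r x) x := by
  have := hasDerivAt_abs_rpow x hr
  rwa [mul_assoc] at this

lemma psi_eq_of_nonneg {r x : ℝ} (hr : 1 < r) (hx : 0 ≤ x) : psi r x = x ^ (r - 1) := by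
  rw [← abs_of_nonneg (psi_nonneg hx), abs_psi hr, abs_of_nonneg hx]

/-- derivative of `|x|^r x`. -/
lemma hasDerivAt_abs_rpow_mul {r : ℝ} (hr : 1 < r) (x : ℝ) :
    HasDerivAt (fun x : ℝ => |x| ^ r * x) ((r + 1) * |x| ^ r) x := by
  have h := (hasDerivAt_abs_rpow' hr x).fun_mul (hasDerivAt_id' x)
  refine h.congr_deriv ?_
  have e := psi_mul_self hr x
  linear_combination r * e

/-- Clarkson-type convexity inequality. -/
lemma convex_gain {p : ℝ} (hp : 2 < p) (a b : ℝ) :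
    |a| ^ p + p * psi p a * (b - a) + 2 ^ (1 - p) * |b - a| ^ p ≤ |b| ^ p := by
  -- tangent line
  have tang : ∀ y : ℝ, |a| ^ p + p * psi p a * (y - a) ≤ |y| ^ p := by
    intro y
    have hc : ConvexOn ℝ Set.univ (fun x : ℝ => |x| ^ p) := by
      refine ⟨convex_univ, ?_⟩
      intro x _ y _ s t hs ht hst
      simp only [smul_eq_mul]
      calc |s * x + t * y| ^ p ≤ (s * |x| + t * |y|) ^ p := by
            apply rpow_le_rpow (abs_nonneg _) _ (by linarith)
            calc _ ≤ |s * x| + |t * y| := abs_add_le _ _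
              _ = _ := by rw [abs_mul, abs_mul, abs_of_nonneg hs, abs_of_nonneg ht]
        _ ≤ _ := by
            have ha2 : |x| ∈ Set.Ici (0:ℝ) := abs_nonneg x
            have hb2 : |y| ∈ Set.Ici (0:ℝ) := abs_nonneg y
            have := (convexOn_rpow (by linarith : 1 ≤ p)).2 ha2 hb2 hs ht hst
            simpa only [smul_eq_mul] using this
    have hd := hasDerivAt_abs_rpow' (by linarith : 1 < p) a
    rcases lt_trichotomy a y with h | h | h
    · have := hc.le_slope_of_hasDerivAt (Set.mem_univ _) (Set.mem_univ _) h hd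
      rw [slope_def_field, le_div_iff₀ (by linarith)] at this
      linarith
    · subst h; simp
    · have := hc.slope_le_of_hasDerivAt (Set.mem_univ _) (Set.mem_univ _) h hd
      rw [slope_def_field, div_le_iff₀ (by linarith)] at this
      linarith
  have t1 := tang ((a + b) / 2)
  have hsq : ∀ x : ℝ, (x ^ 2) ^ (p / 2) = |x| ^ p := by
    intro x
    rw [← sq_abs, ← rpow_natCast, ← rpow_mul (abs_nonneg _)]
    congr 1; push_cast; ring
  have c1 : |(a + b) / 2| ^ p + |(b - a) / 2| ^ p ≤ (|a| ^ p + |b| ^ p) / 2 := by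
    rw [← hsq, ← hsq, ← hsq, ← hsq]
    calc _ ≤ (((a + b) / 2) ^ 2 + ((b - a) / 2) ^ 2) ^ (p / 2) :=
          add_rpow_le_rpow_add (sq_nonneg _) (sq_nonneg _) (by linarith)
      _ = ((1 / 2) * a ^ 2 + (1 / 2) * b ^ 2) ^ (p / 2) := by congr 1; ring
      _ ≤ (1 / 2) * (a ^ 2) ^ (p / 2) + (1 / 2) * (b ^ 2) ^ (p / 2) := by
          have h1 : (0:ℝ) ≤ 1 / 2 := by norm_num
          have h2 : (1:ℝ) / 2 + 1 / 2 = 1 := by norm_num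
          have ha2 : a ^ 2 ∈ Set.Ici (0:ℝ) := sq_nonneg a
          have hb2 : b ^ 2 ∈ Set.Ici (0:ℝ) := sq_nonneg b
          have := (convexOn_rpow (by linarith : 1 ≤ p / 2)).2 ha2 hb2 h1 h1 h2
          simpa only [smul_eq_mul] using this
      _ = _ := by ring
  have e : |(b - a) / 2| ^ p = 2 ^ (1 - p) * |b - a| ^ p / 2 := by
    rw [abs_div, div_rpow (abs_nonneg _) (abs_nonneg _), abs_two, rpow_sub two_pos, rpow_one]
    have : (0:ℝ) < 2 ^ p := by positivity
    field_simp
  rw [e] at c1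
  have e2 : (a + b) / 2 - a = (b - a) / 2 := by ring
  rw [e2] at t1
  linarith

lemma perNorm_eq (r : ℝ) (u : ℝ → ℝ) : perNorm r u = (av (fun x => |u x| ^ r)) ^ (1 / r) := rfl

lemma perNorm_sq (r : ℝ) (u : ℝ → ℝ) : perNorm r u ^ 2 = (av (fun x => |u x| ^ r)) ^ (2 / r) := by
  rw [perNorm_eq, ← rpow_natCast, ← rpow_mul (av_nonneg (fun x => by positivity))]
  congr 1
  push_cast
  ring

lemma lambda_bdd (p : ℝ) : BddBelow { l : ℝ | ∃ v : ℝ → ℝ, PeriodicC1 v ∧ v ≠ 0 ∧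
    (∫ x in (0:ℝ)..(2 * π), v x) = 0 ∧
    l = (perNorm p (deriv v)) ^ 2 / (perNorm p v) ^ 2 } := by
  refine ⟨0, ?_⟩
  rintro l ⟨v, _, _, _, rfl⟩
  positivity

lemma lambda_nonneg (p : ℝ) : 0 ≤ lambdaOne p := by
  apply Real.sInf_nonneg
  rintro l ⟨v, _, _, _, rfl⟩
  positivity

lemma PeriodicC1.diff {u : ℝ → ℝ} (hu : PeriodicC1 u) (x : ℝ) : HasDerivAt u (deriv u x) x :=
  (hu.2.differentiable one_ne_zero x).hasDerivAt

lemma PeriodicC1.cont_deriv {u : ℝ → ℝ} (hu : PeriodicC1 u) : Continuous (deriv u) :=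
  hu.2.continuous_deriv le_rfl

lemma PeriodicC1.per_deriv {u : ℝ → ℝ} (hu : PeriodicC1 u) :
    Function.Periodic (deriv u) (2 * π) := by
  intro x
  rw [← deriv_comp_add_const]
  congr 1
  ext y
  exact hu.1 y

lemma periodicC1_of {u u' : ℝ → ℝ} (hp : Function.Periodic u (2 * π))
    (hd : ∀ x, HasDerivAt u (u' x) x) (hc : Continuous u') : PeriodicC1 u := by
  refine ⟨hp, ?_⟩
  rw [contDiff_one_iff_deriv]
  refine ⟨fun x => (hd x).differentiableAt, ?_⟩
  have : deriv u = u' := by ext x; exact (hd x).deriv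
  rwa [this]

lemma lambda_le_one (p : ℝ) (hp : 2 < p) : lambdaOne p ≤ 1 := by
  have hs : PeriodicC1 sin := ⟨sin_periodic, contDiff_sin⟩
  have hne : sin ≠ 0 := by
    intro h
    have := congrFun h (π / 2)
    simp at this
  have hint : (∫ x in (0:ℝ)..(2 * π), sin x) = 0 := by
    rw [integral_sin]; simp
  have h1 : lambdaOne p ≤ (perNorm p (deriv sin)) ^ 2 / (perNorm p sin) ^ 2 :=
    csInf_le (lambda_bdd p) ⟨sin, hs, hne, hint, rfl⟩
  refine h1.trans ?_
  have h2 : perNorm p (deriv sin) = perNorm p sin := by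
    rw [perNorm_eq, perNorm_eq]
    congr 1
    unfold av
    congr 1
    have e : ∀ x, |deriv sin x| ^ p = |sin (x + π / 2)| ^ p := by
      intro x
      rw [Real.deriv_sin, sin_add_pi_div_two]
    simp only [e]
    rw [intervalIntegral.integral_comp_add_right (fun x => |sin x| ^ p)]
    have hper : Function.Periodic (fun x => |sin x| ^ p) (2 * π) := by
      intro x
      simp only [sin_periodic x]
    have := hper.intervalIntegral_add_eq (π / 2) 0
    rw [zero_add] at this
    rw [← this]
    congr 1 <;> ring
  rw [h2]
  exact div_self_le_one _

lemma PeriodicC1.sub_const {u : ℝ → ℝ} (hu : PeriodicC1 u) (m : ℝ) :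
    PeriodicC1 (fun x => u x - m) :=
  periodicC1_of (fun x => by simp only [hu.1 x]) (fun x => (hu.diff x).sub_const m) hu.cont_deriv

lemma lambda_poincare (p : ℝ) (hp : 2 < p) {u : ℝ → ℝ} (hu : PeriodicC1 u) :
    lambdaOne p * (av (fun x => |u x - av u| ^ p)) ^ (2 / p) ≤
      (av (fun x => |deriv u x| ^ p)) ^ (2 / p) := by
  have hv := hu.sub_const (av u)
  have hd : deriv (fun x => u x - av u) = deriv u := by
    ext x; exact deriv_sub_const _
  rcases eq_or_ne (fun x => u x - av u) 0 with h0 | h0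
  · have e : ∀ x, u x - av u = 0 := fun x => congrFun h0 x
    simp only [e, abs_zero]
    rw [zero_rpow (by linarith), av_const, zero_rpow (by positivity), mul_zero]
    exact rpow_nonneg (av_nonneg (fun x => by positivity)) _
  · have hint : (∫ x in (0:ℝ)..(2 * π), (u x - av u)) = 0 := by
      have h1 := av_sub hu.2.continuous (continuous_const (y := av u))
      rw [av_const, sub_self] at h1
      unfold av at h1 ⊢
      have h2 : (1 / (2 * π)) ≠ 0 := by positivity
      exact (mul_eq_zero.1 h1).resolve_left h2
    have h1 : lambdaOne p ≤ _ := csInf_le (lambda_bdd p) ⟨_, hv, h0, hint, rfl⟩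
    rw [hd, perNorm_sq, perNorm_sq] at h1
    obtain ⟨y, hy⟩ := Function.ne_iff.1 h0
    have hpos : 0 < av (fun x => |u x - av u| ^ p) := by
      apply av_pos (y := y)
      · exact cont_abs_rpow hv.2.continuous (by linarith)
      · intro x; simp only [hu.1 x]
      · intro x; positivity
      · have : 0 < |u y - av u| := abs_pos.2 hy
        positivity
    rwa [le_div_iff₀ (by positivity)] at h1

lemma deriv_zero_of_min {u : ℝ → ℝ} (hu0 : ∀ x, 0 ≤ u x) {x : ℝ} (hx : u x = 0) :
    deriv u x = 0 := by
  have : IsLocalMin u x := Filter.Eventually.of_forall (fun y => by rw [hx]; exact hu0 y)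
  exact this.deriv_eq_zero

lemma ratio_tendsto {u G : ℝ → ℝ} (hu : Continuous u) (hu0 : ∀ x, 0 ≤ u x) (hG : Continuous G)
    (hz : ∀ x, u x = 0 → G x = 0) {s : ℝ} (hs : 0 < s) :
    Filter.Tendsto (fun ε : ℝ => av (fun x => (u x + ε) ^ (-s) * u x ^ s * G x))
      (nhdsWithin 0 (Set.Ioi 0)) (nhds (av G)) := by
  obtain ⟨C, hC⟩ := (isCompact_Icc (a := (0:ℝ)) (b := 2 * π)).exists_bound_of_continuousOn
    hG.continuousOn
  have hpos : ∀ ε : ℝ, 0 < ε → ∀ x, 0 < u x + ε := fun ε hε x => by linarith [hu0 x]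
  apply av_tendsto C
  · filter_upwards [self_mem_nhdsWithin] with ε hε
    have hε : 0 < ε := hε
    refine Continuous.mul (Continuous.mul ?_ ?_) hG
    · exact (hu.add continuous_const).rpow_const (fun x => Or.inl (hpos ε hε x).ne')
    · exact hu.rpow_const (fun x => Or.inr hs.le)
  · filter_upwards [self_mem_nhdsWithin] with ε hε x hx
    have hε : 0 < ε := hε
    have h1 := hC x hx
    rw [norm_eq_abs] at h1
    have hp := hpos ε hε x
    rw [abs_mul, rpow_neg hp.le, abs_of_nonneg (by have := hu0 x; positivity)]
    have : ((u x + ε) ^ s)⁻¹ * u x ^ s ≤ 1 := by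
      rw [inv_mul_le_iff₀ (by positivity), mul_one]
      exact rpow_le_rpow (hu0 x) (by linarith) hs.le
    calc _ ≤ 1 * |G x| := by gcongr
      _ ≤ C := by linarith
  · intro x
    rcases eq_or_ne (u x) 0 with h | h
    · simp [hz x h]
    · have hx : 0 < u x := lt_of_le_of_ne (hu0 x) (Ne.symm h)
      have h1 : ContinuousAt (fun ε : ℝ => (u x + ε) ^ (-s) * u x ^ s * G x) 0 := by
        refine ContinuousAt.mul (ContinuousAt.mul ?_ continuousAt_const) continuousAt_const
        refine ContinuousAt.rpow_const (by fun_prop) (Or.inl ?_)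
        simpa using h
      have h2 := h1.tendsto
      simp only [add_zero] at h2
      rw [← rpow_add hx] at h2
      simp only [neg_add_cancel, rpow_zero, one_mul] at h2
      exact h2.mono_left nhdsWithin_le_nhds

lemma param_tendsto {F : ℝ → ℝ → ℝ} (hF : Continuous (Function.uncurry F)) :
    Filter.Tendsto (fun ε : ℝ => av (F ε)) (nhdsWithin 0 (Set.Ioi 0)) (nhds (av (F 0))) := by
  have h : Continuous (fun ε => av (F ε)) := by
    unfold av
    exact continuous_const.mul
      (intervalIntegral.continuous_parametric_intervalIntegral_of_continuous' hF _ _)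
  exact (h.tendsto 0).mono_left nhdsWithin_le_nhds

lemma cdc_first {p q h β : ℝ} (hp : 2 < p) (hq : p - 1 < q) {u : ℝ → ℝ} (hu : PeriodicC1 u)
    (hu0 : ∀ x, 0 ≤ u x)
    (hw : ∀ x, HasDerivAt (fun y => psi p (deriv u y))
      (-(h * u x ^ (p - 1) - β * u x ^ (q - 1))) x)
    (hK : 0 < av (fun x => |deriv u x| ^ p)) (hP : 0 < av (fun x => u x ^ p)) :
    lambdaOne p * (av (fun x => u x ^ p)) ^ (2 / p - 1) *
      (av (fun x => |deriv u x| ^ p)) ^ (2 - 2 / p) ≤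
    av (fun x => (h * u x ^ (p - 1) - β * u x ^ (q - 1)) *
      (h * u x - β * u x ^ (q + 1 - p))) := by
  have cu := hu.2.continuous
  have cD := hu.cont_deriv
  have hp1 : 1 < p := by linarith
  set D := deriv u with hD
  set K := av (fun x => |D x| ^ p) with hKdef
  set P := av (fun x => u x ^ p) with hPdef
  set f : ℝ → ℝ := fun x => h * u x ^ (p - 1) - β * u x ^ (q - 1) with hf
  set g : ℝ → ℝ := fun x => h * u x - β * u x ^ (q + 1 - p) with hg
  have cw : Continuous (fun y => psi p (D y)) := (continuous_psi hp1).comp cD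
  have cpow : ∀ s : ℝ, 0 ≤ s → Continuous (fun x => u x ^ s) := fun s hs =>
    cu.rpow_const (fun _ => Or.inr hs)
  have cf : Continuous f :=
    (continuous_const.fun_mul (cpow _ (by linarith))).fun_sub (continuous_const.fun_mul (cpow _ (by linarith)))
  have cg : Continuous g :=
    (continuous_const.fun_mul cu).fun_sub (continuous_const.fun_mul (cpow _ (by linarith)))
  have hper0 : u (2 * π) = u 0 := by have := hu.1 0; simpa using this
  have hperD : D (2 * π) = D 0 := by have := hu.per_deriv 0; simpa using this
  -- average of f vanishes
  have avf : av f = 0 := by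
    have := av_parts (f := fun _ => (1:ℝ)) (f' := fun _ => 0) (fun x => hasDerivAt_const x 1) hw
      continuous_const cf.neg (by simp only [hperD])
    simp only [one_mul, zero_mul, av_const, neg_zero] at this
    rw [av_neg] at this
    linarith
  have hKfu : K = av (fun x => f x * u x) := by
    have := av_parts (f := fun y => psi p (D y)) (g := u) (g' := D) hw hu.diff cf.neg cD
      (by simp only [hperD, hper0])
    simp only [psi_mul_self hp1] at this
    rw [hKdef, this, ← av_neg]
    congr 1
    ext x
    ring
  set m := av u with hm
  have hKfm : K = av (fun x => f x * (u x - m)) := by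
    have e : (fun x => f x * (u x - m)) = fun x => f x * u x - m * f x := by ext x; ring
    rw [e, av_sub (cf.fun_mul cu) (continuous_const.fun_mul cf), av_cmul, avf, hKfu]
    ring
  have hfg : ∀ x, f x = u x ^ (p - 2) * g x := by
    intro x
    simp only [hf, hg]
    rcases (hu0 x).eq_or_lt with h0 | h0
    · rw [← h0, zero_rpow (by linarith), zero_rpow (by linarith), zero_rpow (by linarith)]
      ring
    · have e1 : u x ^ (p - 1) = u x ^ (p - 2) * u x := by
        nth_rw 3 [← rpow_one (u x)]
        rw [← rpow_add h0]; congr 1; ring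
      have e2 : u x ^ (q - 1) = u x ^ (p - 2) * u x ^ (q + 1 - p) := by
        rw [← rpow_add h0]; congr 1; ring
      rw [e1, e2]; ring
  have hsq : ∀ x, u x ^ ((p - 2) / 2) * u x ^ ((p - 2) / 2) = u x ^ (p - 2) := by
    intro x
    rw [← rpow_add_of_nonneg (hu0 x) (by linarith) (by linarith)]
    congr 1; ring
  have cB : Continuous (fun x => u x ^ ((p - 2) / 2)) := cpow _ (by linarith)
  have cs := av_cs (cB.fun_mul cg) (cB.fun_mul (cu.fun_sub (continuous_const (y := m))))
  have e1 : (fun x => u x ^ ((p - 2) / 2) * g x * (u x ^ ((p - 2) / 2) * (u x - m))) =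
      fun x => f x * (u x - m) := by
    ext x; rw [hfg, ← hsq]; ring
  have e2 : (fun x => (u x ^ ((p - 2) / 2) * g x) ^ 2) = fun x => f x * g x := by
    ext x; rw [hfg, ← hsq]; ring
  have e3 : (fun x => (u x ^ ((p - 2) / 2) * (u x - m)) ^ 2) =
      fun x => u x ^ (p - 2) * |u x - m| ^ (2:ℝ) := by
    ext x; rw [← hsq, rpow_two, sq_abs]; ring
  rw [e1, e2, e3, ← hKfm] at cs
  have hconj : (p / (p - 2)).HolderConjugate (p / 2) := by
    rw [Real.holderConjugate_iff]
    constructor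
    · rw [one_lt_div (by linarith)]; linarith
    · rw [inv_div, inv_div]
      field_simp
      ring
  have hol := av_holder hconj (cpow (p - 2) (by linarith))
    (cont_abs_rpow (cu.fun_sub (continuous_const (y := m))) zero_le_two)
    (fun x => rpow_nonneg (hu0 x) _) (fun x => by positivity)
  have e4 : ∀ x, (u x ^ (p - 2)) ^ (p / (p - 2)) = u x ^ p := by
    intro x
    rw [← rpow_mul (hu0 x)]
    congr 1
    have : p - 2 ≠ 0 := by linarith
    field_simp
  have e5 : ∀ x, (|u x - m| ^ (2:ℝ)) ^ (p / 2) = |u x - m| ^ p := by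
    intro x
    rw [← rpow_mul (abs_nonneg _)]
    congr 1
    field_simp
  simp only [e4, e5, one_div_div] at hol
  rw [← hPdef] at hol
  have poin := lambda_poincare p hp hu
  rw [← hm, ← hD, ← hKdef] at poin
  set V := av (fun x => |u x - m| ^ p) with hV
  have hfgnn : 0 ≤ av (fun x => f x * g x) := by
    rw [← e2]; exact av_nonneg (fun x => sq_nonneg _)
  have hl := lambda_nonneg p
  have main : lambdaOne p * K ^ 2 ≤ av (fun x => f x * g x) * (P ^ ((p - 2) / p) * K ^ (2 / p)) := by
    calc lambdaOne p * K ^ 2 ≤ lambdaOne p * (av (fun x => f x * g x) *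
          (P ^ ((p - 2) / p) * V ^ (2 / p))) := by
          apply mul_le_mul_of_nonneg_left _ hl
          exact cs.trans (mul_le_mul_of_nonneg_left hol hfgnn)
      _ = av (fun x => f x * g x) * (P ^ ((p - 2) / p) * (lambdaOne p * V ^ (2 / p))) := by ring
      _ ≤ _ := by gcongr
  have hp0 : p ≠ 0 := by linarith
  have r1 : P ^ (2 / p - 1) * P ^ ((p - 2) / p) = 1 := by
    rw [← rpow_add hP]
    have : 2 / p - 1 + (p - 2) / p = 0 := by field_simp; ring
    rw [this, rpow_zero]
  have r2 : K ^ (2 - 2 / p) * K ^ (2 / p) = K ^ 2 := by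
    rw [← rpow_add hK, ← rpow_natCast]
    congr 1; push_cast; ring
  have hkp : 0 < P ^ ((p - 2) / p) * K ^ (2 / p) := by positivity
  refine le_of_mul_le_mul_right ?_ hkp
  calc lambdaOne p * P ^ (2 / p - 1) * K ^ (2 - 2 / p) * (P ^ ((p - 2) / p) * K ^ (2 / p))
      = lambdaOne p * (P ^ (2 / p - 1) * P ^ ((p - 2) / p)) * (K ^ (2 - 2 / p) * K ^ (2 / p)) := by
        ring
    _ = lambdaOne p * K ^ 2 := by rw [r1, r2]; ring
    _ ≤ _ := main

lemma cdc_second {p q h β : ℝ} (hp : 2 < p) (hq : p - 1 < q) {u : ℝ → ℝ} (hu : PeriodicC1 u)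
    (hu0 : ∀ x, 0 ≤ u x)
    (hw : ∀ x, HasDerivAt (fun y => psi p (deriv u y))
      (-(h * u x ^ (p - 1) - β * u x ^ (q - 1))) x)
    (hP : 0 < av (fun x => u x ^ p)) {ε : ℝ} (hε : 0 < ε) :
    av (fun x => (h * u x ^ (p - 1) - β * u x ^ (q - 1)) *
      (h * (u x + ε) - β * (u x + ε) ^ (q + 1 - p))) +
    (p - 1) ^ 2 / (2 * p - 1) * (1 + q - p) * (av (fun x => |deriv u x| ^ p) ^ 2 /
      av (fun x => (u x + ε) ^ p)) ≤
    h * av (fun x => |deriv u x| ^ p) - (1 + q - p) * h *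
      av (fun x => (u x + ε) ^ (-(p - 1)) * u x ^ (p - 1) * |deriv u x| ^ p)
    - (1 + q - p) * β * (av (fun x => (u x + ε) ^ (q - p) * |deriv u x| ^ p) -
      av (fun x => (u x + ε) ^ (-(p - 1)) * (u x ^ (q - 1) * |deriv u x| ^ p))) := by
  have cu := hu.2.continuous
  have cD := hu.cont_deriv
  have hp1 : 1 < p := by linarith
  set D := deriv u with hD
  set K := av (fun x => |D x| ^ p) with hKdef
  set f : ℝ → ℝ := fun x => h * u x ^ (p - 1) - β * u x ^ (q - 1) with hf
  have cpow : ∀ s : ℝ, 0 ≤ s → Continuous (fun x => u x ^ s) := fun s hs =>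
    cu.rpow_const (fun _ => Or.inr hs)
  have cf : Continuous f :=
    (continuous_const.fun_mul (cpow _ (by linarith))).fun_sub (continuous_const.fun_mul (cpow _ (by linarith)))
  have cw : Continuous (fun y => psi p (D y)) := (continuous_psi hp1).comp cD
  have hper0 : u (2 * π) = u 0 := by have := hu.1 0; simpa using this
  have hperD : D (2 * π) = D 0 := by have := hu.per_deriv 0; simpa using this
  have hpos : ∀ x, 0 < u x + ε := fun x => by linarith [hu0 x]
  have cue : Continuous (fun x => u x + ε) := cu.add continuous_const
  have cpe : ∀ s : ℝ, Continuous (fun x => (u x + ε) ^ s) := fun s =>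
    cue.rpow_const (fun x => Or.inl (hpos x).ne')
  have cDp : Continuous (fun x => |D x| ^ p) := cont_abs_rpow cD (by linarith)
  have due : ∀ s x : ℝ, HasDerivAt (fun x => (u x + ε) ^ s) (D x * s * (u x + ε) ^ (s - 1)) x := by
    intro s x
    exact ((hu.diff x).add_const ε).rpow_const (Or.inl (hpos x).ne')
  -- S5
  have S5 : av (fun x => f x * (h * (u x + ε) - β * (u x + ε) ^ (q + 1 - p))) =
      h * K - (1 + q - p) * β * av (fun x => (u x + ε) ^ (q - p) * |D x| ^ p) := by
    have hg : ∀ x, HasDerivAt (fun x => h * (u x + ε) - β * (u x + ε) ^ (q + 1 - p))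
        (h * D x - β * (D x * (q + 1 - p) * (u x + ε) ^ (q + 1 - p - 1))) x := fun x =>
      (((hu.diff x).add_const ε).const_mul h).fun_sub ((due _ x).const_mul β)
    have := av_parts (f := fun y => psi p (D y)) hw hg cf.neg
      ((continuous_const.fun_mul cD).sub
        (continuous_const.fun_mul ((cD.fun_mul continuous_const).fun_mul (cpe _))))
      (by simp only [hperD, hper0])
    have e : (fun x => psi p (D x) * (h * D x - β * (D x * (q + 1 - p) * (u x + ε) ^ (q + 1 - p - 1))))
        = fun x => h * |D x| ^ p - ((1 + q - p) * β) * ((u x + ε) ^ (q - p) * |D x| ^ p) := by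
      ext x
      rw [← psi_mul_self hp1]
      have : q + 1 - p - 1 = q - p := by ring
      rw [this]; ring
    rw [e, av_sub (continuous_const.fun_mul cDp) (continuous_const.fun_mul ((cpe _).fun_mul cDp)),
      av_cmul, av_cmul, ← hKdef, ← av_neg] at this
    rw [this]
    congr 1
    ext x
    ring
  -- S6
  set Y := av (fun x => (u x + ε) ^ (-p) * (|D x| ^ p) ^ 2) with hY
  have S6 : (2 * p - 1) * av (fun x => (u x + ε) ^ (-(p - 1)) * (|D x| ^ p * f x)) = - ((p - 1) ^ 2 * Y) := by
    set r := p / (p - 1) with hr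
    have hr1 : 1 < r := by rw [hr, one_lt_div (by linarith)]; linarith
    have habs : ∀ x, |psi p (D x)| ^ r = |D x| ^ p := by
      intro x
      rw [abs_psi hp1, ← rpow_mul (abs_nonneg _)]
      congr 1
      have : p - 1 ≠ 0 := by linarith
      rw [hr]; field_simp
    have hZ : ∀ x, HasDerivAt (fun y => |psi p (D y)| ^ r * psi p (D y))
        ((r + 1) * |psi p (D x)| ^ r * (-f x)) x := fun x =>
      HasDerivAt.comp (h₂ := fun t : ℝ => |t| ^ r * t) x (hasDerivAt_abs_rpow_mul hr1 (psi p (D x))) (hw x)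
    have := av_parts (due (-(p - 1))) hZ
      ((cD.fun_mul continuous_const).fun_mul (cpe _))
      ((continuous_const.fun_mul (cont_abs_rpow cw (by linarith))).fun_mul cf.neg)
      (by simp only [hperD, hper0])
    have e1 : (fun x => (u x + ε) ^ (-(p - 1)) * ((r + 1) * |psi p (D x)| ^ r * -f x)) =
        fun x => (-(r + 1)) * ((u x + ε) ^ (-(p - 1)) * (|D x| ^ p * f x)) := by
      ext x; rw [habs]; ring
    have e2 : (fun x => D x * -(p - 1) * (u x + ε) ^ (-(p - 1) - 1) * (|psi p (D x)| ^ r * psi p (D x))) =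
        fun x => (-(p - 1)) * ((u x + ε) ^ (-p) * (|D x| ^ p) ^ 2) := by
      ext x
      rw [habs, sq]
      nth_rw 3 [← psi_mul_self hp1]
      have : -(p - 1) - 1 = -p := by ring
      rw [this]; ring
    rw [e1, e2, av_cmul, av_cmul, ← hY] at this
    have hr2 : (p - 1) * (r + 1) = 2 * p - 1 := by
      have : p - 1 ≠ 0 := by linarith
      rw [hr]; field_simp; ring
    rw [← hr2]
    linear_combination (-(p - 1)) * this
  -- S7
  have hPe : 0 < av (fun x => (u x + ε) ^ p) := by
    refine hP.trans_le (av_mono (cpow _ (by linarith)) (cpe _) ?_)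
    intro x
    exact rpow_le_rpow (hu0 x) (by linarith) (by linarith)
  have S7 : K ^ 2 / av (fun x => (u x + ε) ^ p) ≤ Y := by
    rw [div_le_iff₀ hPe]
    have := av_cs ((cpe (-(p / 2))).fun_mul cDp) (cpe (p / 2))
    have e1 : (fun x => (u x + ε) ^ (-(p / 2)) * |D x| ^ p * (u x + ε) ^ (p / 2)) =
        fun x => |D x| ^ p := by
      ext x
      rw [mul_right_comm, ← rpow_add (hpos x)]
      simp
    have e2 : (fun x => ((u x + ε) ^ (-(p / 2)) * |D x| ^ p) ^ 2) =
        fun x => (u x + ε) ^ (-p) * (|D x| ^ p) ^ 2 := by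
      ext x
      rw [mul_pow, ← rpow_mul_natCast (hpos x).le]
      congr 2; push_cast; ring
    have e3 : (fun x => ((u x + ε) ^ (p / 2)) ^ 2) = fun x => (u x + ε) ^ p := by
      ext x
      rw [← rpow_mul_natCast (hpos x).le]
      congr 1; push_cast; ring
    rwa [e1, e2, e3] at this
  have S8 : av (fun x => (u x + ε) ^ (-(p - 1)) * (|D x| ^ p * f x)) =
      h * av (fun x => (u x + ε) ^ (-(p - 1)) * u x ^ (p - 1) * |D x| ^ p) -
      β * av (fun x => (u x + ε) ^ (-(p - 1)) * (u x ^ (q - 1) * |D x| ^ p)) := by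
    rw [← av_cmul, ← av_cmul, ← av_sub]
    · congr 1; ext x; simp only [hf]; ring
    · exact continuous_const.fun_mul (((cpe _).fun_mul (cpow _ (by linarith))).fun_mul cDp)
    · exact continuous_const.fun_mul ((cpe _).fun_mul ((cpow _ (by linarith)).fun_mul cDp))
  rw [S8] at S6
  have h2p : 0 < 2 * p - 1 := by linarith
  have S7' : (p - 1) ^ 2 / (2 * p - 1) * (1 + q - p) * (K ^ 2 / av (fun x => (u x + ε) ^ p)) ≤
      (p - 1) ^ 2 / (2 * p - 1) * (1 + q - p) * Y := by
    apply mul_le_mul_of_nonneg_left S7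
    apply mul_nonneg
    · positivity
    · linarith
  have S9 : (p - 1) ^ 2 / (2 * p - 1) * (1 + q - p) * Y = (1 + q - p) * (-(
      h * av (fun x => (u x + ε) ^ (-(p - 1)) * u x ^ (p - 1) * |D x| ^ p) -
      β * av (fun x => (u x + ε) ^ (-(p - 1)) * (u x ^ (q - 1) * |D x| ^ p)))) := by
    generalize av (fun x => (u x + ε) ^ (-(p - 1)) * u x ^ (p - 1) * |D x| ^ p) = A at S6 ⊢
    generalize av (fun x => (u x + ε) ^ (-(p - 1)) * (u x ^ (q - 1) * |D x| ^ p)) = B at S6 ⊢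
    have h3 : (p - 1) ^ 2 * Y = (2 * p - 1) * -(h * A - β * B) := by linarith
    have h4 : (p - 1) ^ 2 / (2 * p - 1) * Y = -(h * A - β * B) := by
      rw [div_mul_eq_mul_div, h3, mul_div_cancel_left₀ _ h2p.ne']
    linear_combination (1 + q - p) * h4
  change av (fun x => f x * _) + _ ≤ _
  rw [S5]
  linarith

lemma cdc {p q h β : ℝ} (hp : 2 < p) (hq : p - 1 < q) (hpq : q ≠ p) {u : ℝ → ℝ} (hu : PeriodicC1 u)
    (hu0 : ∀ x, 0 ≤ u x)
    (hw : ∀ x, HasDerivAt (fun y => psi p (deriv u y))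
      (-(h * u x ^ (p - 1) - β * u x ^ (q - 1))) x)
    (hh : 0 ≤ (p - q) * h)
    (hK : 0 < av (fun x => |deriv u x| ^ p)) (hP : 0 < av (fun x => u x ^ p)) :
    lambdaOne p * (av (fun x => u x ^ p)) ^ (2 / p - 1) *
      (av (fun x => |deriv u x| ^ p)) ^ (2 - 2 / p) +
    (p - 1) ^ 2 / (2 * p - 1) * (1 + q - p) * (av (fun x => |deriv u x| ^ p) ^ 2 /
      av (fun x => u x ^ p)) ≤ h * (p - q) * av (fun x => |deriv u x| ^ p) := by
  have first := cdc_first hp hq hu hu0 hw hK hP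
  have second := fun ε (hε : 0 < ε) => cdc_second hp hq hu hu0 hw hP (ε := ε) hε
  have cu := hu.2.continuous
  have cD := hu.cont_deriv
  have hp1 : 1 < p := by linarith
  have hz : ∀ x, u x = 0 → deriv u x = 0 := fun x hx => deriv_zero_of_min hu0 hx
  have hperD : deriv u (2 * π) = deriv u 0 := by have := hu.per_deriv 0; simpa using this
  set D := deriv u with hD
  set K := av (fun x => |D x| ^ p) with hKdef
  set P := av (fun x => u x ^ p) with hPdef
  set c := (p - 1) ^ 2 / (2 * p - 1) * (1 + q - p) with hc
  have cpow : ∀ s : ℝ, 0 ≤ s → Continuous (fun x => u x ^ s) := fun s hs =>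
    cu.rpow_const (fun _ => Or.inr hs)
  have cDp : Continuous (fun x => |D x| ^ p) := cont_abs_rpow cD (by linarith)
  have hzp : ∀ x, u x = 0 → |D x| ^ p = 0 := fun x hx => by
    rw [hz x hx, abs_zero, zero_rpow (by linarith)]
  have cpe2 : ∀ s : ℝ, 0 ≤ s → Continuous (fun z : ℝ × ℝ => (u z.2 + z.1) ^ s) := fun s hs =>
    ((cu.comp continuous_snd).add continuous_fst).rpow_const (fun _ => Or.inr hs)
  have c2pow : ∀ s : ℝ, 0 ≤ s → Continuous (fun z : ℝ × ℝ => u z.2 ^ s) := fun s hs =>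
    (cpow s hs).comp continuous_snd
  have T1 := param_tendsto (F := fun ε x => (h * u x ^ (p - 1) - β * u x ^ (q - 1)) *
      (h * (u x + ε) - β * (u x + ε) ^ (q + 1 - p))) (by
        refine Continuous.fun_mul (((c2pow (p - 1) (by linarith)).const_mul h).fun_sub
          ((c2pow (q - 1) (by linarith)).const_mul β)) (Continuous.fun_sub ?_
          ((cpe2 (q + 1 - p) (by linarith)).const_mul β))
        fun_prop)
  have T2 := param_tendsto (F := fun ε x => (u x + ε) ^ p) (cpe2 p (by linarith))
  simp only [add_zero] at T1 T2
  have T3 := ratio_tendsto cu hu0 cDp hzp (s := p - 1) (by linarith)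
  have TL := T1.add ((tendsto_const_nhds (x := K ^ 2)).div T2 hP.ne' |>.const_mul c)
  have cpe : ∀ ε, 0 < ε → ∀ s : ℝ, Continuous (fun x => (u x + ε) ^ s) := fun ε hε s =>
    (cu.add continuous_const).rpow_const (fun x => Or.inl (by linarith [hu0 x] : (0:ℝ) < u x + ε).ne')
  have TR0 := (tendsto_const_nhds (x := h * K) (f := nhdsWithin (0:ℝ) (Set.Ioi 0))).sub
    (T3.const_mul ((1 + q - p) * h))
  have mem : ∀ᶠ ε : ℝ in nhdsWithin (0:ℝ) (Set.Ioi 0), 0 < ε := self_mem_nhdsWithin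
  have key : av (fun x => (h * u x ^ (p - 1) - β * u x ^ (q - 1)) *
      (h * u x - β * u x ^ (q + 1 - p))) + c * (K ^ 2 / P) ≤
      h * K - (1 + q - p) * h * K := by
    rcases lt_or_gt_of_ne hpq with hlt | hgt
    · -- q < p
      have hh0 : 0 ≤ h := by
        by_contra hneg
        push Not at hneg
        nlinarith
      have avf : h * av (fun x => u x ^ (p - 1)) - β * av (fun x => u x ^ (q - 1)) = 0 := by
        have := av_parts (f := fun _ => (1:ℝ)) (f' := fun _ => 0) (fun x => hasDerivAt_const x 1) hw
          continuous_const (((continuous_const.fun_mul (cpow (p - 1) (by linarith))).fun_sub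
            (continuous_const.fun_mul (cpow (q - 1) (by linarith)))).fun_neg)
          (by simp only [hperD])
        simp only [one_mul, zero_mul, av_const, neg_zero] at this
        rw [av_neg, av_sub (continuous_const.fun_mul (cpow (p - 1) (by linarith)))
          (continuous_const.fun_mul (cpow (q - 1) (by linarith))), av_cmul, av_cmul] at this
        linarith
      have hβ : 0 ≤ β := by
        have hex : ∃ y, u y ≠ 0 := by
          by_contra hno
          push Not at hno
          have : P = 0 := by
            rw [hPdef]; simp only [hno]; rw [zero_rpow (by linarith), av_const]
          linarith
        obtain ⟨y, hy⟩ := hex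
        have hpos : 0 < av (fun x => u x ^ (q - 1)) := by
          refine av_pos (cpow _ (by linarith)) (fun x => by simp only [hu.1 x])
            (fun x => rpow_nonneg (hu0 x) _) (y := y) ?_
          exact (rpow_pos_of_pos (lt_of_le_of_ne (hu0 y) hy.symm) _).ne'
        have h1 : 0 ≤ av (fun x => u x ^ (p - 1)) := av_nonneg (fun x => rpow_nonneg (hu0 x) _)
        by_contra hneg
        push Not at hneg
        have := mul_neg_of_neg_of_pos hneg hpos
        have := mul_nonneg hh0 h1
        linarith
      refine le_of_tendsto_of_tendsto TL TR0 ?_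
      filter_upwards [mem] with ε hε
      have := second ε hε
      have hX : av (fun x => (u x + ε) ^ (-(p - 1)) * (u x ^ (q - 1) * |D x| ^ p)) ≤
          av (fun x => (u x + ε) ^ (q - p) * |D x| ^ p) := by
        refine av_mono ((cpe ε hε _).fun_mul ((cpow _ (by linarith)).fun_mul cDp))
          ((cpe ε hε _).fun_mul cDp) ?_
        intro x
        have hpos : 0 < u x + ε := by linarith [hu0 x]
        have e : (u x + ε) ^ (q - p) = (u x + ε) ^ (-(p - 1)) * (u x + ε) ^ (q - 1) := by
          rw [← rpow_add hpos]; congr 1; ring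
        rw [e, mul_assoc]
        have : u x ^ (q - 1) ≤ (u x + ε) ^ (q - 1) :=
          rpow_le_rpow (hu0 x) (by linarith) (by linarith)
        gcongr
      have hr : 0 ≤ (1 + q - p) * β * (av (fun x => (u x + ε) ^ (q - p) * |D x| ^ p) -
          av (fun x => (u x + ε) ^ (-(p - 1)) * (u x ^ (q - 1) * |D x| ^ p))) := by
        apply mul_nonneg (mul_nonneg (by linarith) hβ) (by linarith)
      dsimp only [Pi.sub_apply, Pi.add_apply, Pi.mul_apply, Pi.div_apply]
      linarith
    · -- q > p
      have T4 := param_tendsto (F := fun ε x => (u x + ε) ^ (q - p) * |D x| ^ p)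
        ((cpe2 (q - p) (by linarith)).fun_mul (cDp.comp continuous_snd))
      simp only [add_zero] at T4
      have T5 := ratio_tendsto cu hu0 (G := fun x => u x ^ (q - p) * |D x| ^ p)
        ((cpow _ (by linarith)).fun_mul cDp) (fun x hx => by rw [hzp x hx, mul_zero])
        (s := p - 1) (by linarith)
      have e : ∀ ε x : ℝ, (u x + ε) ^ (-(p - 1)) * u x ^ (p - 1) * (u x ^ (q - p) * |D x| ^ p) =
          (u x + ε) ^ (-(p - 1)) * (u x ^ (q - 1) * |D x| ^ p) := by
        intro ε x
        have : u x ^ (q - 1) = u x ^ (p - 1) * u x ^ (q - p) := by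
          rw [← rpow_add_of_nonneg (hu0 x) (by linarith) (by linarith)]; congr 1; ring
        rw [this]; ring
      simp only [e] at T5
      have TR := TR0.sub ((T4.sub T5).const_mul ((1 + q - p) * β))
      rw [sub_self, mul_zero, sub_zero] at TR
      refine le_of_tendsto_of_tendsto TL TR ?_
      filter_upwards [mem] with ε hε
      have := second ε hε
      dsimp only [Pi.sub_apply, Pi.add_apply, Pi.mul_apply, Pi.div_apply]
      linarith
  nlinarith [first, key]

lemma osc_aux {p A : ℝ} (hp : 2 < p) (hA : 0 < A) (t : ℝ) : |t| ≤ A + A ^ (1 - p) * |t| ^ p := by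
  rcases le_or_gt |t| A with h | h
  · have : 0 ≤ A ^ (1 - p) * |t| ^ p := by positivity
    linarith
  · have ht : 0 < |t| := hA.trans h
    have h1 : 1 ≤ A ^ (1 - p) * |t| ^ (p - 1) := by
      have e : A ^ (1 - p) * A ^ (p - 1) = 1 := by
        rw [← rpow_add hA]; simp
      refine e.symm.le.trans ?_
      exact mul_le_mul_of_nonneg_left (rpow_le_rpow hA.le h.le (by linarith)) (by positivity)
    have e : |t| ^ p = |t| ^ (p - 1) * |t| := by
      nth_rw 3 [← rpow_one |t|]
      rw [← rpow_add ht]; congr 1; ring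
    rw [e, ← mul_assoc]
    nlinarith

lemma osc_bound {p : ℝ} (hp : 2 < p) {g : ℝ → ℝ} (hg : PeriodicC1 g) {A : ℝ} (hA : 0 < A)
    {x y : ℝ} (hxy : |x - y| ≤ 2 * π) :
    |g x - g y| ≤ A * |x - y| + A ^ (1 - p) * (2 * π * av (fun x => |deriv g x| ^ p)) := by
  wlog hle : y ≤ x generalizing x y with H
  · have := H (x := y) (y := x) (by rwa [abs_sub_comm]) (by linarith)
    rwa [abs_sub_comm (g x), abs_sub_comm x]
  have cD := hg.cont_deriv
  have cDp : Continuous (fun x => |deriv g x| ^ p) := cont_abs_rpow cD (by linarith)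
  rw [abs_of_nonneg (sub_nonneg.2 hle)] at hxy ⊢
  have e : g x - g y = ∫ t in y..x, deriv g t := by
    rw [intervalIntegral.integral_eq_sub_of_hasDerivAt (fun t _ => hg.diff t)
      (cD.intervalIntegrable _ _)]
  rw [e]
  have h1 : |∫ t in y..x, deriv g t| ≤ ∫ t in y..x, |deriv g t| :=
    intervalIntegral.abs_integral_le_integral_abs hle
  have h2 : ∫ t in y..x, |deriv g t| ≤ ∫ t in y..x, (A + A ^ (1 - p) * |deriv g t| ^ p) := by
    apply intervalIntegral.integral_mono hle (cD.abs.intervalIntegrable _ _)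
      ((continuous_const.fun_add (continuous_const.fun_mul cDp)).intervalIntegrable _ _)
    intro t
    exact osc_aux hp hA _
  have h3 : ∫ t in y..x, (A + A ^ (1 - p) * |deriv g t| ^ p) =
      A * (x - y) + A ^ (1 - p) * ∫ t in y..x, |deriv g t| ^ p := by
    rw [intervalIntegral.integral_add (continuous_const.intervalIntegrable _ _)
      ((continuous_const.fun_mul cDp).intervalIntegrable _ _), intervalIntegral.integral_const_mul]
    simp [mul_comm]
  have h4 : ∫ t in y..x, |deriv g t| ^ p ≤ 2 * π * av (fun x => |deriv g x| ^ p) := by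
    have hper : Function.Periodic (fun x => |deriv g x| ^ p) (2 * π) := fun x => by
      simp only [hg.per_deriv x]
    have e1 : 2 * π * av (fun x => |deriv g x| ^ p) = ∫ t in y..(y + 2 * π), |deriv g t| ^ p := by
      have := hper.intervalIntegral_add_eq y 0
      rw [this]
      unfold av
      rw [zero_add]
      have := two_pi_pos'
      field_simp
    rw [e1]
    apply intervalIntegral.integral_mono_interval le_rfl hle (by linarith)
    · exact Filter.Eventually.of_forall (fun t => by positivity)
    · exact cDp.intervalIntegrable _ _
  have h5 : 0 ≤ A ^ (1 - p) := by positivity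
  nlinarith [mul_le_mul_of_nonneg_left h4 h5]

lemma arzela {v : ℕ → ℝ → ℝ} (hc : ∀ n, Continuous (v n))
    (hper : ∀ n, Function.Periodic (v n) (2 * π)) {M : ℝ} (hM : ∀ n x, |v n x| ≤ M)
    (heq : ∀ ε > 0, ∃ δ > 0, ∀ n x y, |x - y| < δ → |v n x - v n y| < ε) :
    ∃ φ : ℕ → ℕ, StrictMono φ ∧ ∃ u : ℝ → ℝ, Continuous u ∧ Function.Periodic u (2 * π) ∧
      ∀ ε > 0, ∀ᶠ n in Filter.atTop, ∀ x, |v (φ n) x - u x| < ε := by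
  have : Fact (0 < 2 * π) := ⟨two_pi_pos'⟩
  have cl : ∀ n, Continuous ((hper n).lift) := fun n =>
    continuous_quot_lift _ (hc n)
  let V : ℕ → BoundedContinuousFunction (AddCircle (2 * π)) ℝ := fun n =>
    BoundedContinuousFunction.mkOfCompact ⟨(hper n).lift, cl n⟩
  have hV : ∀ n (x : ℝ), V n (x : AddCircle (2 * π)) = v n x := fun n x => rfl
  have hcomp := BoundedContinuousFunction.arzela_ascoli (Set.Icc (-M) M) isCompact_Icc (Set.range V)
    (by
      rintro f x ⟨n, rfl⟩
      obtain ⟨y, rfl⟩ := QuotientAddGroup.mk_surjective x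
      exact abs_le.1 (hM n y))
    (by
      intro x
      obtain ⟨y, rfl⟩ := QuotientAddGroup.mk_surjective x
      rw [Metric.equicontinuousAt_iff_right]
      intro ε hε
      obtain ⟨δ, hδ, h⟩ := heq ε hε
      have : nhds ((y : AddCircle (2 * π))) = Filter.map (fun z : ℝ => (z : AddCircle (2 * π))) (nhds y) := by
        exact QuotientAddGroup.nhds_eq _ y
      change ∀ᶠ z in nhds ((y : AddCircle (2 * π))), _
      rw [this, Filter.eventually_map]
      filter_upwards [Metric.ball_mem_nhds y hδ] with z hz
      rintro ⟨f, n, rfl⟩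
      change dist (v n y) (v n z) < ε
      rw [Real.dist_eq]
      apply h
      rw [Metric.mem_ball, Real.dist_eq] at hz
      rwa [abs_sub_comm])
  obtain ⟨f, -, φ, hφ, hf⟩ := hcomp.tendsto_subseq (x := V) (fun n => subset_closure ⟨n, rfl⟩)
  refine ⟨φ, hφ, fun x => f (x : AddCircle (2 * π)), f.continuous.comp (AddCircle.continuous_mk' _), ?_, ?_⟩
  · intro x
    simp
  · intro ε hε
    filter_upwards [(Metric.tendsto_nhds.1 hf) ε hε] with n hn x
    have := (BoundedContinuousFunction.dist_coe_le_dist (f := V (φ n)) (g := f) (x : AddCircle (2 * π))).trans_lt hn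
    rwa [Real.dist_eq] at this

lemma unif_tendsto {v : ℕ → ℝ → ℝ} {u : ℝ → ℝ} (hc : ∀ n, Continuous (v n)) (cu : Continuous u)
    (hlim : ∀ ε > 0, ∀ᶠ n in Filter.atTop, ∀ x, |v n x - u x| < ε) {Φ : ℝ → ℝ → ℝ}
    (cΦ : Continuous (Function.uncurry Φ)) :
    Filter.Tendsto (fun n => av (fun x => Φ x (v n x))) Filter.atTop
      (nhds (av (fun x => Φ x (u x)))) := by
  obtain ⟨M, hM⟩ := (isCompact_Icc (a := (0:ℝ)) (b := 2 * π)).exists_bound_of_continuousOn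
    cu.continuousOn
  obtain ⟨C, hC⟩ := ((isCompact_Icc (a := (0:ℝ)) (b := 2 * π)).prod
    (isCompact_Icc (a := -(M+1)) (b := M + 1))).exists_bound_of_continuousOn cΦ.continuousOn
  refine av_tendsto C (Filter.Eventually.of_forall fun n => ?_) ?_ ?_
  · exact cΦ.comp (continuous_id.prodMk (hc n))
  · filter_upwards [hlim 1 one_pos] with n hn x hx
    have h1 := hn x
    have h2 := hM x hx
    rw [Real.norm_eq_abs] at h2
    have := hC (x, v n x) ⟨hx, by
      rw [abs_lt] at h1
      rw [abs_le] at h2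
      constructor <;> simp only <;> linarith⟩
    exact this
  · intro x
    have : Filter.Tendsto (fun n => v n x) Filter.atTop (nhds (u x)) := by
      rw [Metric.tendsto_nhds]
      intro ε hε
      filter_upwards [hlim ε hε] with n hn
      rw [Real.dist_eq]; exact hn x
    have h := (cΦ.tendsto (x, u x)).comp ((tendsto_const_nhds (x := x)).prodMk_nhds this)
    exact h

/-- solving the ODE psi p (w') = c - ∫ f, w periodic -/
lemma solve_ode {p : ℝ} (hp : 2 < p) {f : ℝ → ℝ} (cf : Continuous f)
    (pf : Function.Periodic f (2 * π)) (h0 : av f = 0) :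
    ∃ w : ℝ → ℝ, PeriodicC1 w ∧ ∀ x, HasDerivAt (fun y => psi p (deriv w y)) (- f x) x := by
  set r := p / (p - 1) with hr
  have hr1 : 1 < r := by rw [hr, one_lt_div (by linarith)]; linarith
  have hconj : p.HolderConjugate r := by
    rw [Real.holderConjugate_iff]
    refine ⟨by linarith, ?_⟩
    have : p - 1 ≠ 0 := by linarith
    have : p ≠ 0 := by linarith
    rw [hr]; field_simp; ring
  have cont_int : ∀ g : ℝ → ℝ, Continuous g → ∀ x, HasDerivAt (fun x => ∫ t in (0:ℝ)..x, g t) (g x) x :=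
    fun g hg x => intervalIntegral.integral_hasDerivAt_right (hg.intervalIntegrable _ _)
      hg.stronglyMeasurable.stronglyMeasurableAtFilter hg.continuousAt
  have per_int : ∀ g : ℝ → ℝ, Continuous g → Function.Periodic g (2 * π) → av g = 0 →
      Function.Periodic (fun x => ∫ t in (0:ℝ)..x, g t) (2 * π) := by
    intro g hg pg hg0 x
    have h1 := intervalIntegral.integral_add_adjacent_intervals (μ := volume)
      (hg.intervalIntegrable 0 x) (hg.intervalIntegrable x (x + 2 * π))
    have h2 := pg.intervalIntegral_add_eq x 0
    have h3 : ∫ t in (0:ℝ)..(2 * π), g t = 0 := by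
      unfold av at hg0
      have : (1 / (2 * π)) ≠ 0 := by have := two_pi_pos'; positivity
      exact (mul_eq_zero.1 hg0).resolve_left this
    rw [zero_add, h3] at h2
    simp only
    rw [← h1, h2, add_zero]
  set F : ℝ → ℝ := fun x => ∫ t in (0:ℝ)..x, f t with hF
  have dF := cont_int f cf
  have cF : Continuous F := continuous_iff_continuousAt.2 fun x => (dF x).continuousAt
  have pF : Function.Periodic F (2 * π) := per_int f cf pf h0
  have cψ := continuous_psi hr1
  have cS : Continuous (fun c : ℝ => av (fun x => psi r (c - F x))) := by
    unfold av
    refine continuous_const.mul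
      (intervalIntegral.continuous_parametric_intervalIntegral_of_continuous' ?_ _ _)
    exact cψ.comp (continuous_fst.sub (cF.comp continuous_snd))
  obtain ⟨M, hM⟩ := (isCompact_Icc (a := (0:ℝ)) (b := 2 * π)).exists_bound_of_continuousOn
    cF.continuousOn
  have hM' : ∀ x, |F x| ≤ M := by
    intro x
    obtain ⟨y, hy, hxy⟩ := pF.exists_mem_Ico₀ two_pi_pos' x
    rw [hxy]; exact hM y ⟨hy.1, hy.2.le⟩
  have hM0 : 0 ≤ M := (abs_nonneg _).trans (hM' 0)
  have hup : 0 ≤ av (fun x => psi r (M - F x)) :=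
    av_nonneg fun x => psi_nonneg (by linarith [(abs_le.1 (hM' x)).2])
  have hdn : av (fun x => psi r (-M - F x)) ≤ 0 := by
    have := av_nonneg (f := fun x => - psi r (-M - F x)) fun x => by
      have := psi_nonpos (r := r) (x := -M - F x) (by linarith [(abs_le.1 (hM' x)).1])
      linarith
    rw [av_neg] at this; linarith
  obtain ⟨c, -, hc⟩ := intermediate_value_Icc (by linarith : -M ≤ M) cS.continuousOn ⟨hdn, hup⟩
  simp only at hc
  have cv : Continuous (fun x => psi r (c - F x)) := cψ.comp (continuous_const.sub cF)
  have pv : Function.Periodic (fun x => psi r (c - F x)) (2 * π) := fun x => by simp only [pF x]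
  have dw := cont_int _ cv
  refine ⟨_, periodicC1_of (per_int _ cv pv hc) dw cv, ?_⟩
  intro x
  have e : (fun y => psi p (deriv (fun x => ∫ t in (0:ℝ)..x, psi r (c - F t)) y)) = fun y => c - F y := by
    ext y
    rw [(dw y).deriv, psi_inv hconj]
  rw [e]
  exact (dF x).const_sub c

lemma regularity {p : ℝ} (hp : 2 < p) {u f : ℝ → ℝ} (cu : Continuous u)
    (pu : Function.Periodic u (2 * π)) (cf : Continuous f) (pf : Function.Periodic f (2 * π))
    {v : ℕ → ℝ → ℝ} (hv : ∀ n, PeriodicC1 (v n))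
    (hlim : ∀ ε > 0, ∀ᶠ n in Filter.atTop, ∀ x, |v n x - u x| < ε) {K : ℝ}
    (hK : Filter.Tendsto (fun n => av (fun x => |deriv (v n) x| ^ p)) Filter.atTop (nhds K))
    (hvar : ∀ w, PeriodicC1 w → p * av (fun x => f x * (w x - u x)) ≤
      av (fun x => |deriv w x| ^ p) - K) :
    PeriodicC1 u ∧ av (fun x => |deriv u x| ^ p) = K ∧
      ∀ x, HasDerivAt (fun y => psi p (deriv u y)) (- f x) x := by
  have hp1 : 1 < p := by linarith
  have h0 : av f = 0 := by
    have hcst : ∀ a : ℝ, p * (a * av f - av (fun x => f x * u x)) ≤ -K := by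
      intro a
      have := hvar (fun _ => a) ⟨fun x => rfl, contDiff_const⟩
      have e1 : av (fun x => f x * (a - u x)) = a * av f - av (fun x => f x * u x) := by
        rw [← av_cmul, ← av_sub (continuous_const.fun_mul cf) (cf.fun_mul cu)]
        congr 1; ext x; ring
      rw [e1] at this
      simp only [deriv_const, abs_zero] at this
      rw [zero_rpow (by linarith), av_const] at this
      linarith
    by_contra hne
    have h1 := hcst ((av (fun x => f x * u x) + (|K| + 1) / p) / av f)
    rw [div_mul_cancel₀ _ hne] at h1
    have : p * (av (fun x => f x * u x) + (|K| + 1) / p - av (fun x => f x * u x)) = |K| + 1 := by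
      field_simp; ring
    rw [this] at h1
    linarith [neg_abs_le K, le_abs_self K, abs_nonneg K, neg_le_abs K]
  obtain ⟨w, hw, hdw⟩ := solve_ode hp cf pf h0
  have cw := hw.2.continuous
  have cDw := hw.cont_deriv
  set G : ℕ → ℝ := fun n => av (fun x => |deriv (v n) x - deriv w x| ^ p) with hG
  have gain : ∀ n, av (fun x => |deriv w x| ^ p) + p * av (fun x => f x * (v n x - w x)) +
      2 ^ (1 - p) * G n ≤ av (fun x => |deriv (v n) x| ^ p) := by
    intro n
    have cD := (hv n).cont_deriv
    have cv := (hv n).2.continuous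
    have cψ : Continuous (fun x => psi p (deriv w x)) := (continuous_psi hp1).comp cDw
    have parts := av_parts (f := fun y => psi p (deriv w y)) (g := fun x => v n x - w x) hdw
      (fun x => ((hv n).diff x).fun_sub (hw.diff x)) cf.fun_neg (cD.fun_sub cDw) (by
        have a1 := (hv n).1 0
        have a2 := hw.1 0
        have a3 := hw.per_deriv 0
        rw [zero_add] at a1 a2 a3
        simp only [a1, a2, a3])
    have e1 : (fun x => - f x * (v n x - w x)) = fun x => - (f x * (v n x - w x)) := by
      ext x; ring
    rw [e1, av_neg, neg_neg] at parts
    rw [← parts, hG]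
    simp only
    rw [← av_cmul, ← av_cmul, ← av_add (cont_abs_rpow cDw (by linarith))
      (continuous_const.fun_mul (cψ.fun_mul (cD.fun_sub cDw))), ← av_add]
    · apply av_mono
      · exact ((cont_abs_rpow cDw (by linarith)).fun_add
          (continuous_const.fun_mul (cψ.fun_mul (cD.fun_sub cDw)))).fun_add
          (continuous_const.fun_mul (cont_abs_rpow (cD.fun_sub cDw) (by linarith)))
      · exact cont_abs_rpow cD (by linarith)
      · intro x
        have := convex_gain hp (deriv w x) (deriv (v n) x)
        linarith
    · exact (cont_abs_rpow cDw (by linarith)).fun_add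
          (continuous_const.fun_mul (cψ.fun_mul (cD.fun_sub cDw)))
    · exact continuous_const.fun_mul (cont_abs_rpow (cD.fun_sub cDw) (by linarith))
  have lim1 := unif_tendsto (fun n => (hv n).2.continuous) cu hlim
    (Φ := fun x y => f x * (y - w x))
    ((cf.comp continuous_fst).fun_mul (continuous_snd.fun_sub (cw.comp continuous_fst)))
  have hvw := hvar w hw
  have esym : av (fun x => f x * (w x - u x)) = - av (fun x => f x * (u x - w x)) := by
    rw [← av_neg]; congr 1; ext x; ring
  have G0 : ∀ n, 0 ≤ G n := fun n => av_nonneg fun x => by positivity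
  have two0 : (0:ℝ) < 2 ^ (1 - p) := by positivity
  have Glim : Filter.Tendsto G Filter.atTop (nhds 0) := by
    have up : Filter.Tendsto (fun n => (2 ^ (1 - p))⁻¹ * (av (fun x => |deriv (v n) x| ^ p) -
        (av (fun x => |deriv w x| ^ p) + p * av (fun x => f x * (v n x - w x)))))
        Filter.atTop (nhds ((2 ^ (1 - p))⁻¹ * (K - (av (fun x => |deriv w x| ^ p) +
          p * av (fun x => f x * (u x - w x)))))) :=
      (hK.sub (tendsto_const_nhds.add (lim1.const_mul p))).const_mul _
    have ub : ∀ n, G n ≤ (2 ^ (1 - p))⁻¹ * (av (fun x => |deriv (v n) x| ^ p) -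
        (av (fun x => |deriv w x| ^ p) + p * av (fun x => f x * (v n x - w x)))) := by
      intro n
      rw [← div_eq_inv_mul, le_div_iff₀ two0]
      linarith [gain n]
    have le0 : (2 ^ (1 - p))⁻¹ * (K - (av (fun x => |deriv w x| ^ p) +
          p * av (fun x => f x * (u x - w x)))) ≤ 0 := by
      apply mul_nonpos_of_nonneg_of_nonpos (by positivity)
      rw [esym] at hvw
      linarith
    have ge0 := ge_of_tendsto' up (fun n => (G0 n).trans (ub n))
    rw [le_antisymm le0 ge0] at up
    exact squeeze_zero G0 ub up
  -- u = w + const on [0,2π]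
  have hconst0 : ∀ x ∈ Set.Icc (0:ℝ) (2 * π), u x - w x = u 0 - w 0 := by
    intro x hx
    have hA : ∀ A : ℝ, 0 < A → |(u x - w x) - (u 0 - w 0)| ≤ A * |x - 0| := by
      intro A hA
      have pt : ∀ y, Filter.Tendsto (fun n => v n y) Filter.atTop (nhds (u y)) := by
        intro y
        rw [Metric.tendsto_nhds]
        intro ε hε
        filter_upwards [hlim ε hε] with n hn
        rw [Real.dist_eq]; exact hn y
      have l := (((pt x).sub_const (w x)).sub ((pt 0).sub_const (w 0))).abs
      have rr : Filter.Tendsto (fun n => A * |x - 0| + A ^ (1 - p) * (2 * π * G n)) Filter.atTop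
          (nhds (A * |x - 0| + A ^ (1 - p) * (2 * π * 0))) :=
        tendsto_const_nhds.add ((Glim.const_mul _).const_mul _)
      rw [mul_zero, mul_zero, add_zero] at rr
      refine le_of_tendsto_of_tendsto' l rr ?_
      intro n
      have hg : PeriodicC1 (fun x => v n x - w x) :=
        periodicC1_of (fun x => by simp only [(hv n).1 x, hw.1 x])
          (fun x => ((hv n).diff x).fun_sub (hw.diff x)) ((hv n).cont_deriv.fun_sub cDw)
      have e : deriv (fun x => v n x - w x) = fun x => deriv (v n) x - deriv w x := by
        ext x; exact (((hv n).diff x).fun_sub (hw.diff x)).deriv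
      have := osc_bound hp hg hA (x := x) (y := 0) (by
        rw [sub_zero, abs_of_nonneg hx.1]; exact hx.2)
      rw [e] at this
      exact this
    have : |(u x - w x) - (u 0 - w 0)| ≤ 0 := by
      have ht : Filter.Tendsto (fun A : ℝ => A * |x - 0|) (nhdsWithin 0 (Set.Ioi 0)) (nhds 0) := by
        have : Continuous (fun A : ℝ => A * |x - 0|) := by fun_prop
        have := (this.tendsto 0).mono_left (nhdsWithin_le_nhds (s := Set.Ioi 0))
        simpa using this
      refine ge_of_tendsto ht ?_
      filter_upwards [self_mem_nhdsWithin] with A hA'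
      exact hA A hA'
    have := abs_nonpos_iff.1 this
    linarith
  have hu : ∀ x, u x = w x - (w 0 - u 0) := by
    intro x
    have pg : Function.Periodic (fun x => u x - w x) (2 * π) := fun x => by
      simp only [pu x, hw.1 x]
    obtain ⟨y, hy, hxy⟩ := pg.exists_mem_Ico₀ two_pi_pos' x
    have := hconst0 y ⟨hy.1, hy.2.le⟩
    linarith
  have hu' : u = fun x => w x - (w 0 - u 0) := funext hu
  have hder : deriv u = deriv w := by
    rw [hu']; ext x; exact ((hw.diff x).sub_const _).deriv
  have huC : PeriodicC1 u := by rw [hu']; exact hw.sub_const _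
  refine ⟨huC, ?_, ?_⟩
  · apply le_antisymm
    · have l2 := ((tendsto_const_nhds (x := av (fun x => |deriv w x| ^ p))).add
        (lim1.const_mul p)).add (Glim.const_mul (2 ^ (1 - p)))
      have := le_of_tendsto_of_tendsto' l2 hK gain
      have e : av (fun x => f x * (u x - w x)) = 0 := by
        have : (fun x => f x * (u x - w x)) = fun x => (u 0 - w 0) * f x := by
          ext x; rw [hu x]; ring
        rw [this, av_cmul, h0, mul_zero]
      rw [e] at this
      rw [hder]
      linarith
    · have := hvar u huC
      simp only [sub_self, mul_zero, av_const] at this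
      linarith
  · rw [hder]; exact hdw

lemma deriv_nonneg_right {φ : ℝ → ℝ} {d : ℝ} (hd : HasDerivAt φ d 0)
    (h : ∀ᶠ t in nhdsWithin (0:ℝ) (Set.Ioi 0), φ 0 ≤ φ t) : 0 ≤ d := by
  have h1 := (hasDerivWithinAt_iff_tendsto_slope' (s := Set.Ioi (0:ℝ)) (by simp)).1
    hd.hasDerivWithinAt
  refine ge_of_tendsto h1 ?_
  filter_upwards [h, self_mem_nhdsWithin] with t ht ht0
  rw [slope_def_field]
  apply div_nonneg
  · linarith
  · simpa using ht0.le

lemma hasDerivAt_av_pow {r : ℝ} (hr : 1 < r) {u e : ℝ → ℝ} (cu : Continuous u) (ce : Continuous e) :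
    HasDerivAt (fun t => av (fun x => |u x + t * e x| ^ r))
      (r * av (fun x => psi r (u x) * e x)) 0 := by
  have hcont : ∀ t : ℝ, Continuous (fun x => u x + t * e x) := fun t => by fun_prop
  have c2 : Continuous (fun z : ℝ × ℝ => r * psi r (u z.2 + z.1 * e z.2) * e z.2) := by
    have := continuous_psi hr
    fun_prop
  obtain ⟨C, hC⟩ := ((isCompact_Icc (a := (-1:ℝ)) (b := 1)).prod
    (isCompact_Icc (a := (0:ℝ)) (b := 2 * π))).exists_bound_of_continuousOn c2.continuousOn
  have key := intervalIntegral.hasDerivAt_integral_of_dominated_loc_of_deriv_le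
    (μ := volume) (a := 0) (b := 2 * π) (𝕜 := ℝ)
    (F := fun t x => |u x + t * e x| ^ r)
    (F' := fun t x => r * psi r (u x + t * e x) * e x) (x₀ := 0) (s := Set.Icc (-1) 1)
    (bound := fun _ => C) (Icc_mem_nhds (by norm_num) (by norm_num))
    (Filter.Eventually.of_forall fun t =>
      (cont_abs_rpow (hcont t) (by linarith)).aestronglyMeasurable)
    ((cont_abs_rpow (hcont 0) (by linarith)).intervalIntegrable _ _)
    (by
      have : Continuous (fun x => r * psi r (u x + 0 * e x) * e x) :=
        c2.comp (continuous_const.prodMk continuous_id)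
      exact this.aestronglyMeasurable)
    (Filter.Eventually.of_forall fun x hx t ht => by
      rw [Set.uIoc_of_le two_pi_pos'.le] at hx
      exact hC (t, x) ⟨ht, hx.1.le, hx.2⟩)
    (continuous_const.intervalIntegrable _ _)
    (Filter.Eventually.of_forall fun x hx t ht => by
      have h1 : HasDerivAt (fun t : ℝ => u x + t * e x) (e x) t := by
        simpa using ((hasDerivAt_id t).mul_const (e x)).const_add (u x)
      exact HasDerivAt.comp (h₂ := fun y : ℝ => |y| ^ r) t (hasDerivAt_abs_rpow' hr _) h1)
  have := key.2.const_mul (1 / (2 * π))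
  refine this.congr_deriv ?_
  rw [← av_cmul]
  unfold av
  simp only [zero_mul, add_zero, mul_assoc]

lemma first_variation {p q k Kw K : ℝ} (hp : 2 < p) (hq : 1 < q) {H : ℝ → ℝ} {u w : ℝ → ℝ}
    (cu : Continuous u) (cw : Continuous w) (hu0 : ∀ x, 0 ≤ u x)
    (hP : 0 < av (fun x => |u x| ^ p)) (hQ : av (fun x => |u x| ^ q) = 1) (hK : 0 < K)
    (hH : HasDerivAt H k (av (fun x => |u x| ^ p) ^ (2 / p)))
    (hmin : ∀ᶠ t in nhdsWithin (0:ℝ) (Set.Ioi 0),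
      K ^ (2 / p) - H (av (fun x => |u x| ^ p) ^ (2 / p)) ≤
      (K + t * (Kw - K)) ^ (2 / p) * (av (fun x => |u x + t * (w x - u x)| ^ q)) ^ (-(2 / q)) -
      H ((av (fun x => |u x + t * (w x - u x)| ^ p)) ^ (2 / p) *
        (av (fun x => |u x + t * (w x - u x)| ^ q)) ^ (-(2 / q)))) :
    p * av (fun x => (k * av (fun x => |u x| ^ p) ^ (2 / p - 1) * K ^ (1 - 2 / p) * u x ^ (p - 1) -
      (k * av (fun x => |u x| ^ p) ^ (2 / p) * K ^ (1 - 2 / p) - K) * u x ^ (q - 1)) * (w x - u x))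
      ≤ Kw - K := by
  have hp1 : 1 < p := by linarith
  set P := av (fun x => |u x| ^ p) with hPdef
  have ce : Continuous (fun x => w x - u x) := cw.fun_sub cu
  have dP := hasDerivAt_av_pow hp1 cu ce
  have dQ := hasDerivAt_av_pow hq cu ce
  simp only [psi_eq_of_nonneg hp1 (hu0 _)] at dP
  simp only [psi_eq_of_nonneg hq (hu0 _)] at dQ
  set Ap := av (fun x => u x ^ (p - 1) * (w x - u x)) with hAp
  set Aq := av (fun x => u x ^ (q - 1) * (w x - u x)) with hAq
  have dK : HasDerivAt (fun t : ℝ => K + t * (Kw - K)) (Kw - K) 0 := by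
    simpa using ((hasDerivAt_id (0:ℝ)).mul_const (Kw - K)).const_add K
  have hK0 : K + 0 * (Kw - K) = K := by ring
  have hP0 : av (fun x => |u x + 0 * (w x - u x)| ^ p) = P := by simp [hPdef]
  have hQ0 : av (fun x => |u x + 0 * (w x - u x)| ^ q) = 1 := by simp [hQ]
  have dK2 := dK.rpow_const (p := 2 / p) (Or.inl (by rw [hK0]; exact hK.ne'))
  have dP2 := dP.rpow_const (p := 2 / p) (Or.inl (by rw [hP0]; exact hP.ne'))
  have dQ2 := dQ.rpow_const (p := -(2 / q)) (Or.inl (by rw [hQ0]; exact one_ne_zero))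
  rw [hK0] at dK2
  rw [hP0] at dP2
  rw [hQ0, one_rpow] at dQ2
  have dN := dP2.fun_mul dQ2
  rw [hP0, hQ0, one_rpow] at dN
  have dKQ := dK2.fun_mul dQ2
  rw [hK0, hQ0, one_rpow] at dKQ
  have hN0 : av (fun x => |u x + 0 * (w x - u x)| ^ p) ^ (2 / p) *
      av (fun x => |u x + 0 * (w x - u x)| ^ q) ^ (-(2 / q)) = P ^ (2 / p) := by
    rw [hP0, hQ0, one_rpow, mul_one]
  have dHN := HasDerivAt.comp (h₂ := H) (0:ℝ) (by rw [hN0]; exact hH) dN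
  have dAll := dKQ.sub dHN
  have res := deriv_nonneg_right dAll (by
    filter_upwards [hmin] with t ht
    simp only [Pi.sub_apply, Function.comp]
    rw [hN0, hQ0, hK0, one_rpow, mul_one]
    exact ht)
  have e : av (fun x => (k * P ^ (2 / p - 1) * K ^ (1 - 2 / p) * u x ^ (p - 1) -
      (k * P ^ (2 / p) * K ^ (1 - 2 / p) - K) * u x ^ (q - 1)) * (w x - u x)) =
      k * P ^ (2 / p - 1) * K ^ (1 - 2 / p) * Ap - (k * P ^ (2 / p) * K ^ (1 - 2 / p) - K) * Aq := by
    rw [hAp, hAq, ← av_cmul, ← av_cmul, ← av_sub]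
    · congr 1; ext x; ring
    · exact continuous_const.fun_mul ((cu.rpow_const fun _ => Or.inr (by linarith)).fun_mul ce)
    · exact continuous_const.fun_mul ((cu.rpow_const fun _ => Or.inr (by linarith)).fun_mul ce)
  rw [e]
  have eK1 : K ^ (2 / p - 1) * K ^ (1 - 2 / p) = 1 := by
    rw [← rpow_add hK]; simp
  have eK2 : K ^ (2 / p) * K ^ (1 - 2 / p) = K := by
    rw [← rpow_add hK]; simp
  have hKp : 0 < K ^ (1 - 2 / p) := by positivity
  have hp0 : p ≠ 0 := by linarith
  have hq0 : q ≠ 0 := by linarith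
  have res2 := mul_nonneg res (mul_nonneg (by linarith : 0 ≤ p / 2) hKp.le)
  have a1 : 2 / p * p = 2 := by field_simp
  have a2 : 2 / q * q = 2 := by field_simp
  have c1 : (Kw - K) * (2 / p) * (p / 2) = Kw - K := by field_simp
  have c2 : q * Aq * -(2 / q) = -2 * Aq := by field_simp
  have c3 : p * Ap * (2 / p) = 2 * Ap := by field_simp
  rw [c2, c3] at res2
  rw [← sub_nonneg]
  refine res2.trans_eq ?_
  generalize K ^ (2 / p - 1) = a at *
  generalize K ^ (2 / p) = b at *
  generalize K ^ (1 - 2 / p) = κ at *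
  linear_combination (a * κ) * c1 + (Kw - K) * eK1 - p * Aq * eK2

noncomputable def Iq (p q : ℝ) (u : ℝ → ℝ) : ℝ :=
  (av (fun x => |deriv u x| ^ p)) ^ (2 / p) * (av (fun x => |u x| ^ q)) ^ (-(2 / q))

noncomputable def Nq (p q : ℝ) (u : ℝ → ℝ) : ℝ :=
  (av (fun x => |u x| ^ p)) ^ (2 / p) * (av (fun x => |u x| ^ q)) ^ (-(2 / q))

lemma Iq_nonneg (p q : ℝ) (u : ℝ → ℝ) : 0 ≤ Iq p q u := by
  have h1 : 0 ≤ av (fun x => |deriv u x| ^ p) := av_nonneg fun x => by positivity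
  have h2 : 0 ≤ av (fun x => |u x| ^ q) := av_nonneg fun x => by positivity
  unfold Iq; positivity

lemma av_abs_pos {u : ℝ → ℝ} (cu : Continuous u) (pu : Function.Periodic u (2 * π)) (hu : u ≠ 0)
    {r : ℝ} (hr : 0 < r) : 0 < av (fun x => |u x| ^ r) := by
  obtain ⟨y, hy⟩ := Function.ne_iff.1 hu
  refine av_pos (cont_abs_rpow cu hr.le) (fun x => by simp only [pu x]) (fun x => by positivity)
    (y := y) ?_
  exact (rpow_pos_of_pos (abs_pos.2 hy) _).ne'

lemma scale_inv {A B c p q : ℝ} (hp : 0 < p) (hq : 0 < q) (hA : 0 ≤ A) (hB : 0 ≤ B) (hc : 0 < c) :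
    (c ^ p * A) ^ (2 / p) * (c ^ q * B) ^ (-(2 / q)) = A ^ (2 / p) * B ^ (-(2 / q)) := by
  rw [mul_rpow (by positivity) hA, mul_rpow (by positivity) hB, ← rpow_mul hc.le, ← rpow_mul hc.le]
  have e1 : p * (2 / p) = 2 := by field_simp
  have e2 : q * -(2 / q) = -2 := by field_simp
  rw [e1, e2]
  have : c ^ (2:ℝ) * c ^ (-2:ℝ) = 1 := by rw [← rpow_add hc]; simp
  linear_combination (A ^ (2 / p) * B ^ (-(2 / q))) * this

lemma av_scale {c r : ℝ} (hc : 0 < c) (f : ℝ → ℝ) :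
    av (fun x => |c * f x| ^ r) = c ^ r * av (fun x => |f x| ^ r) := by
  rw [← av_cmul]
  congr 1; ext x
  rw [abs_mul, abs_of_pos hc, mul_rpow hc.le (abs_nonneg _)]

lemma smoothing {p q : ℝ} (hp : 2 < p) (hq : 1 < q) {H : ℝ → ℝ} (hH : Continuous H) {u : ℝ → ℝ}
    (hu : PeriodicC1 u) (hu0 : u ≠ 0) {η : ℝ} (hη : 0 < η) :
    ∃ v, PeriodicC1 v ∧ (∀ x, 0 ≤ v x) ∧ av (fun x => |v x| ^ q) = 1 ∧
      Iq p q v - H (Nq p q v) < Iq p q u - H (Nq p q u) + η := by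
  have cu := hu.2.continuous
  have hQ := av_abs_pos cu hu.1 hu0 (by linarith : 0 < q)
  have hP := av_abs_pos cu hu.1 hu0 (by linarith : 0 < p)
  have cr : ∀ r : ℝ, 0 ≤ r → Continuous (Function.uncurry fun ε x : ℝ => |√(u x ^ 2 + ε ^ 2)| ^ r) := by
    intro r hr
    refine (Continuous.abs ?_).rpow_const (fun _ => Or.inr hr)
    exact (((cu.comp continuous_snd).pow 2).add (continuous_fst.pow 2)).sqrt
  have t0 : ∀ r : ℝ, av (fun x => |√(u x ^ 2 + 0 ^ 2)| ^ r) = av (fun x => |u x| ^ r) := by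
    intro r
    congr 1; ext x
    rw [zero_pow two_ne_zero, add_zero, sqrt_sq_eq_abs, abs_abs]
  have TP := param_tendsto (cr p (by linarith))
  have TQ := param_tendsto (cr q (by linarith))
  simp only [t0] at TP TQ
  have TQ2 := TQ.rpow_const (p := -(2 / q)) (Or.inl hQ.ne')
  have TP2 := TP.rpow_const (p := 2 / p) (Or.inl hP.ne')
  have TH := (hH.tendsto _).comp (TP2.mul TQ2)
  have TA := (TQ2.const_mul (av (fun x => |deriv u x| ^ p) ^ (2 / p))).sub TH
  have ev := (tendsto_order.1 TA).2 (Iq p q u - H (Nq p q u) + η) (by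
    unfold Iq Nq; linarith)
  obtain ⟨ε, hlt, hε⟩ := (ev.and self_mem_nhdsWithin).exists
  replace hε : 0 < ε := hε
  have hpos : ∀ x, 0 < u x ^ 2 + ε ^ 2 := fun x => by positivity
  set v : ℝ → ℝ := fun x => √(u x ^ 2 + ε ^ 2) with hv
  have vpos : ∀ x, 0 < v x := fun x => sqrt_pos.2 (hpos x)
  have cv : Continuous v := ((cu.pow 2).add continuous_const).sqrt
  have dv : ∀ x, HasDerivAt v (u x * deriv u x / v x) x := by
    intro x
    have := (((hu.diff x).fun_pow 2).add_const (ε ^ 2)).sqrt (hpos x).ne'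
    refine this.congr_deriv ?_
    simp only [hv]
    have := (sqrt_pos.2 (hpos x)).ne'
    field_simp
    ring
  have hvC : PeriodicC1 v := periodicC1_of (fun x => by simp only [hv, hu.1 x]) dv
    ((cu.mul hu.cont_deriv).div cv (fun x => (vpos x).ne'))
  have hvd : deriv v = fun x => u x * deriv u x / v x := funext fun x => (dv x).deriv
  have hKle : av (fun x => |deriv v x| ^ p) ≤ av (fun x => |deriv u x| ^ p) := by
    apply av_mono (cont_abs_rpow hvC.cont_deriv (by linarith))
      (cont_abs_rpow hu.cont_deriv (by linarith))
    intro x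
    apply rpow_le_rpow (abs_nonneg _) _ (by linarith)
    rw [hvd]
    simp only
    rw [abs_div, abs_mul, abs_of_pos (vpos x), div_le_iff₀ (vpos x), mul_comm]
    apply mul_le_mul_of_nonneg_left _ (abs_nonneg _)
    rw [← sqrt_sq_eq_abs]
    apply sqrt_le_sqrt
    nlinarith [sq_nonneg ε]
  have hQv : 0 < av (fun x => |v x| ^ q) := av_abs_pos cv hvC.1 (fun h => by
    have := vpos 0; rw [h] at this; simp at this) (by linarith)
  have hKv0 : 0 ≤ av (fun x => |deriv v x| ^ p) := av_nonneg fun x => by positivity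
  have hPv0 : 0 ≤ av (fun x => |v x| ^ p) := av_nonneg fun x => by positivity
  have hFv : Iq p q v - H (Nq p q v) < Iq p q u - H (Nq p q u) + η := by
    refine lt_of_le_of_lt ?_ hlt
    simp only [Function.comp]
    unfold Iq Nq
    apply sub_le_sub_right
    apply mul_le_mul_of_nonneg_right _ (by positivity)
    exact rpow_le_rpow hKv0 hKle (by positivity)
  set c := (av (fun x => |v x| ^ q)) ^ (-(1 / q)) with hc
  have hcpos : 0 < c := by positivity
  have dcv : ∀ x, HasDerivAt (fun x => c * v x) (c * deriv v x) x := fun x => (hvC.diff x).const_mul c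
  have hdc : deriv (fun x => c * v x) = fun x => c * deriv v x := funext fun x => (dcv x).deriv
  refine ⟨fun x => c * v x, periodicC1_of (fun x => by simp only [hvC.1 x]) dcv
    (continuous_const.mul hvC.cont_deriv), fun x => (mul_pos hcpos (vpos x)).le, ?_, ?_⟩
  · rw [av_scale hcpos, hc, ← rpow_mul hQv.le]
    have : -(1 / q) * q = -1 := by field_simp
    rw [this, rpow_neg_one, inv_mul_cancel₀ hQv.ne']
  · have e1 : Iq p q (fun x => c * v x) = Iq p q v := by
      unfold Iq
      rw [hdc, av_scale hcpos, av_scale hcpos, scale_inv (by linarith) (by linarith) hKv0 hQv.le hcpos]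
    have e2 : Nq p q (fun x => c * v x) = Nq p q v := by
      unfold Nq
      rw [av_scale hcpos, av_scale hcpos, scale_inv (by linarith) (by linarith) hPv0 hQv.le hcpos]
    rw [e1, e2]; exact hFv

lemma const_of_tendsto {p : ℝ} (hp : 2 < p) {u : ℝ → ℝ} (pu : Function.Periodic u (2 * π))
    {v : ℕ → ℝ → ℝ} (hv : ∀ n, PeriodicC1 (v n))
    (hlim : ∀ ε > 0, ∀ᶠ n in Filter.atTop, ∀ x, |v n x - u x| < ε)
    (hK : Filter.Tendsto (fun n => av (fun x => |deriv (v n) x| ^ p)) Filter.atTop (nhds 0)) :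
    ∀ x, u x = u 0 := by
  have pt : ∀ y, Filter.Tendsto (fun n => v n y) Filter.atTop (nhds (u y)) := by
    intro y
    rw [Metric.tendsto_nhds]
    intro ε hε
    filter_upwards [hlim ε hε] with n hn
    rw [Real.dist_eq]; exact hn y
  have main : ∀ x ∈ Set.Icc (0:ℝ) (2 * π), u x = u 0 := by
    intro x hx
    have hA : ∀ A : ℝ, 0 < A → |u x - u 0| ≤ A * |x - 0| := by
      intro A hA
      have l := ((pt x).sub (pt 0)).abs
      have rr := (tendsto_const_nhds (x := A * |x - 0|)).add
        ((hK.const_mul (2 * π)).const_mul (A ^ (1 - p)))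
      rw [mul_zero, mul_zero, add_zero] at rr
      refine le_of_tendsto_of_tendsto' l rr ?_
      intro n
      exact osc_bound hp (hv n) hA (x := x) (y := 0) (by
        rw [sub_zero, abs_of_nonneg hx.1]; exact hx.2)
    have : |u x - u 0| ≤ 0 := by
      have ht : Filter.Tendsto (fun A : ℝ => A * |x - 0|) (nhdsWithin 0 (Set.Ioi 0)) (nhds 0) := by
        have : Continuous (fun A : ℝ => A * |x - 0|) := by fun_prop
        have := (this.tendsto 0).mono_left (nhdsWithin_le_nhds (s := Set.Ioi 0))
        simpa using this
      refine ge_of_tendsto ht ?_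
      filter_upwards [self_mem_nhdsWithin] with A hA'
      exact hA A hA'
    have := abs_nonpos_iff.1 this
    linarith
  intro x
  obtain ⟨y, hy, hxy⟩ := pu.exists_mem_Ico₀ two_pi_pos' x
  rw [hxy]; exact main y ⟨hy.1, hy.2.le⟩

lemma abs_rpow_convex {p t : ℝ} (hp : 2 < p) (ht0 : 0 ≤ t) (ht1 : t ≤ 1) (a b : ℝ) :
    |a + t * (b - a)| ^ p ≤ |a| ^ p + t * (|b| ^ p - |a| ^ p) := by
  have h1 : |a + t * (b - a)| ≤ (1 - t) * |a| + t * |b| := by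
    have : a + t * (b - a) = (1 - t) * a + t * b := by ring
    rw [this]
    refine (abs_add_le _ _).trans ?_
    rw [abs_mul, abs_mul, abs_of_nonneg ht0, abs_of_nonneg (by linarith : 0 ≤ 1 - t)]
  have h2 := (convexOn_rpow (by linarith : 1 ≤ p)).2 (Set.mem_Ici.2 (abs_nonneg a))
    (Set.mem_Ici.2 (abs_nonneg b)) (by linarith : 0 ≤ 1 - t) ht0 (by ring)
  simp only [smul_eq_mul] at h2
  calc |a + t * (b - a)| ^ p ≤ ((1 - t) * |a| + t * |b|) ^ p :=
        rpow_le_rpow (abs_nonneg _) h1 (by linarith)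
    _ ≤ _ := by linarith

/-- compactness for a minimizing sequence -/
lemma compactness {p q : ℝ} (hp : 2 < p) (hq : 1 < q) {v : ℕ → ℝ → ℝ} (hv : ∀ n, PeriodicC1 (v n))
    (hv0 : ∀ n x, 0 ≤ v n x) (hQ : ∀ n, av (fun x => |v n x| ^ q) = 1) {B : ℝ}
    (hB : ∀ n, av (fun x => |deriv (v n) x| ^ p) ≤ B) :
    ∃ φ : ℕ → ℕ, StrictMono φ ∧ ∃ u : ℝ → ℝ, Continuous u ∧ Function.Periodic u (2 * π) ∧
      ∀ ε > 0, ∀ᶠ n in Filter.atTop, ∀ x, |v (φ n) x - u x| < ε := by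
  have hpi := two_pi_pos'
  have hB0 : 0 ≤ B := (av_nonneg fun x => by positivity).trans (hB 0)
  refine arzela (fun n => (hv n).2.continuous) (fun n => (hv n).1)
    (M := 2 + (1 * (2 * π) + 1 ^ (1 - p) * (2 * π * B))) ?_ ?_
  · intro n x
    have hex : ∃ y, v n y ≤ 2 := by
      by_contra hno
      push Not at hno
      have h1 : av (fun _ => (2:ℝ) ^ q) ≤ av (fun x => |v n x| ^ q) := by
        apply av_mono continuous_const (cont_abs_rpow (hv n).2.continuous (by linarith))
        intro y
        apply rpow_le_rpow (by norm_num) _ (by linarith)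
        exact (hno y).le.trans (le_abs_self _)
      rw [hQ n, av_const] at h1
      have := one_lt_rpow (by norm_num : (1:ℝ) < 2) (by linarith : 0 < q)
      linarith
    obtain ⟨y, hy⟩ := hex
    obtain ⟨x', hx', ex⟩ := (hv n).1.exists_mem_Ico₀ hpi x
    obtain ⟨y', hy', ey⟩ := (hv n).1.exists_mem_Ico₀ hpi y
    have hd : |x' - y'| ≤ 2 * π := by
      rw [abs_le]; constructor <;> linarith [hx'.1, hx'.2, hy'.1, hy'.2]
    have := osc_bound hp (hv n) one_pos hd
    rw [abs_of_nonneg (hv0 n x)]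
    have h3 := (le_abs_self _).trans this
    rw [← ex, ← ey] at h3
    have h4 : 1 * |x' - y'| + 1 ^ (1 - p) * (2 * π * av (fun x => |deriv (v n) x| ^ p)) ≤
        1 * (2 * π) + 1 ^ (1 - p) * (2 * π * B) := by
      rw [one_rpow]
      have := mul_le_mul_of_nonneg_left (hB n) hpi.le
      linarith
    linarith
  · intro ε hε
    have hA : ∃ A : ℝ, 0 < A ∧ A ^ (1 - p) * (2 * π * B) < ε / 2 := by
      have h1 := (tendsto_rpow_neg_atTop (by linarith : 0 < p - 1)).mul_const (2 * π * B)
      rw [zero_mul] at h1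
      have h2 := (tendsto_order.1 h1).2 (ε / 2) (by linarith)
      obtain ⟨A, h3, h4⟩ := (h2.and (Filter.eventually_gt_atTop 0)).exists
      refine ⟨A, h4, ?_⟩
      have : -(p - 1) = 1 - p := by ring
      rwa [this] at h3
    obtain ⟨A, hA0, hA⟩ := hA
    refine ⟨min (ε / (2 * A)) (2 * π), lt_min (by positivity) hpi, ?_⟩
    intro n x y hxy
    have h1 := osc_bound hp (hv n) hA0 (hxy.le.trans (min_le_right _ _))
    have h2 : A * |x - y| < ε / 2 := by
      have := mul_lt_mul_of_pos_left (hxy.trans_le (min_le_left _ _)) hA0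
      have e : A * (ε / (2 * A)) = ε / 2 := by field_simp
      linarith
    have h3 : A ^ (1 - p) * (2 * π * av (fun x => |deriv (v n) x| ^ p)) ≤
        A ^ (1 - p) * (2 * π * B) := by
      have := hB n
      gcongr
    linarith

lemma hmin_of_min {p q J K Kw : ℝ} (hp : 2 < p) (hq : 1 < q) {H : ℝ → ℝ} (cH : Continuous H)
    (hJ : ∀ w, PeriodicC1 w → w ≠ 0 → J ≤ Iq p q w - H (Nq p q w))
    {v : ℕ → ℝ → ℝ} (hv : ∀ n, PeriodicC1 (v n)) {u : ℝ → ℝ} (cu : Continuous u)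
    (hlim : ∀ ε > 0, ∀ᶠ n in Filter.atTop, ∀ x, |v n x - u x| < ε)
    (hQ : av (fun x => |u x| ^ q) = 1)
    (hKlim : Filter.Tendsto (fun n => av (fun x => |deriv (v n) x| ^ p)) Filter.atTop (nhds K))
    {w : ℝ → ℝ} (hw : PeriodicC1 w) (hKw : Kw = av (fun x => |deriv w x| ^ p)) :
    ∀ᶠ t in nhdsWithin (0:ℝ) (Set.Ioi 0), J ≤
      (K + t * (Kw - K)) ^ (2 / p) * (av (fun x => |u x + t * (w x - u x)| ^ q)) ^ (-(2 / q)) -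
      H ((av (fun x => |u x + t * (w x - u x)| ^ p)) ^ (2 / p) *
        (av (fun x => |u x + t * (w x - u x)| ^ q)) ^ (-(2 / q))) := by
  have cw := hw.2.continuous
  have hQt : ∀ᶠ t in nhdsWithin (0:ℝ) (Set.Ioi 0), 0 < av (fun x => |u x + t * (w x - u x)| ^ q) := by
    have h1 := (hasDerivAt_av_pow hq cu (cw.fun_sub cu)).continuousAt
    have h2 := (tendsto_order.1 h1).1 0 (by simp [hQ])
    exact nhdsWithin_le_nhds h2
  have hlt1 : ∀ᶠ t in nhdsWithin (0:ℝ) (Set.Ioi 0), t < 1 :=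
    nhdsWithin_le_nhds (eventually_lt_nhds one_pos)
  filter_upwards [hQt, hlt1, self_mem_nhdsWithin] with t ht ht1 ht0
  replace ht0 : 0 < t := ht0
  have cΦ : ∀ r : ℝ, 0 ≤ r → Continuous (Function.uncurry fun x y : ℝ => |y + t * (w x - y)| ^ r) := by
    intro r hr
    refine (Continuous.abs ?_).rpow_const (fun _ => Or.inr hr)
    have : Continuous (fun z : ℝ × ℝ => w z.1) := cw.comp continuous_fst
    exact continuous_snd.add (continuous_const.mul (this.sub continuous_snd))
  have hcv := fun n => (hv n).2.continuous
  have TP := unif_tendsto hcv cu hlim (cΦ p (by linarith))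
  have TQ := unif_tendsto hcv cu hlim (cΦ q (by linarith))
  have TQ2 := TQ.rpow_const (p := -(2 / q)) (Or.inl ht.ne')
  have TP2 := TP.rpow_const (p := 2 / p) (Or.inr (by positivity))
  have TK := (hKlim.add ((hKlim.const_sub Kw).const_mul t)).rpow_const (p := 2 / p)
    (Or.inr (by positivity))
  have TH := (cH.tendsto _).comp (TP2.mul TQ2)
  refine ge_of_tendsto ((TK.mul TQ2).sub TH) ?_
  filter_upwards [(tendsto_order.1 TQ).1 0 ht] with n hn
  have dz : ∀ x, HasDerivAt (fun x => v n x + t * (w x - v n x))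
      (deriv (v n) x + t * (deriv w x - deriv (v n) x)) x := fun x =>
    ((hv n).diff x).fun_add (((hw.diff x).fun_sub ((hv n).diff x)).const_mul t)
  have hz : PeriodicC1 (fun x => v n x + t * (w x - v n x)) :=
    periodicC1_of (fun x => by simp only [(hv n).1 x, hw.1 x]) dz
      ((hv n).cont_deriv.fun_add (continuous_const.fun_mul (hw.cont_deriv.fun_sub (hv n).cont_deriv)))
  have hdz : deriv (fun x => v n x + t * (w x - v n x)) =
      fun x => deriv (v n) x + t * (deriv w x - deriv (v n) x) := funext fun x => (dz x).deriv
  have hne : (fun x => v n x + t * (w x - v n x)) ≠ 0 := by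
    intro h
    have : ∀ x, v n x + t * (w x - v n x) = 0 := fun x => congrFun h x
    simp only [this, abs_zero] at hn
    rw [zero_rpow (by linarith), av_const] at hn
    exact lt_irrefl _ hn
  refine (hJ _ hz hne).trans ?_
  simp only [Function.comp]
  unfold Iq Nq
  apply sub_le_sub_right
  apply mul_le_mul_of_nonneg_right _ (rpow_nonneg hn.le _)
  apply rpow_le_rpow (av_nonneg fun x => by positivity) _ (by positivity)
  rw [hdz, hKw, ← av_sub (cont_abs_rpow hw.cont_deriv (by linarith))
    (cont_abs_rpow (hv n).cont_deriv (by linarith)), ← av_cmul, ← av_add]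
  · apply av_mono
    · exact cont_abs_rpow ((hv n).cont_deriv.fun_add (continuous_const.fun_mul
        (hw.cont_deriv.fun_sub (hv n).cont_deriv))) (by linarith)
    · exact (cont_abs_rpow (hv n).cont_deriv (by linarith)).fun_add (continuous_const.fun_mul
        ((cont_abs_rpow hw.cont_deriv (by linarith)).fun_sub
        (cont_abs_rpow (hv n).cont_deriv (by linarith))))
    · intro x
      exact abs_rpow_convex hp ht0.le ht1.le _ _
  · exact cont_abs_rpow (hv n).cont_deriv (by linarith)
  · exact continuous_const.fun_mul
        ((cont_abs_rpow hw.cont_deriv (by linarith)).fun_sub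
        (cont_abs_rpow (hv n).cont_deriv (by linarith)))

lemma main_lemma {p q : ℝ} (hp : 2 < p) (hq : p - 1 < q) (hpq : q ≠ p) {H k : ℝ → ℝ}
    (hH : ∀ n, HasDerivAt H (k n) n) {B : ℝ} (hB : ∀ n, H n ≤ B) (H1 : H 1 ≤ 0)
    (hk : ∀ n, 0 ≤ (p - q) * k n)
    (cond : ∀ u, PeriodicC1 u → (∀ x, 0 ≤ u x) → av (fun x => |u x| ^ q) = 1 →
      0 < av (fun x => |deriv u x| ^ p) →
      (p - q) * k (Nq p q u) < lambdaOne p + (p - 1) ^ 2 / (2 * p - 1) * (1 + q - p) *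
        (Iq p q u / Nq p q u)) :
    ∀ u, PeriodicC1 u → u ≠ 0 → H (Nq p q u) ≤ Iq p q u := by
  by_contra hcon
  push Not at hcon
  obtain ⟨u0, hu0, hu0ne, hlt⟩ := hcon
  have hq1 : 1 < q := by linarith
  have cH : Continuous H := continuous_iff_continuousAt.2 fun x => (hH x).continuousAt
  set S : Set ℝ := {y | ∃ u, PeriodicC1 u ∧ u ≠ 0 ∧ y = Iq p q u - H (Nq p q u)} with hS
  have hSb : BddBelow S := ⟨-B, by
    rintro y ⟨u, -, -, rfl⟩
    linarith [Iq_nonneg p q u, hB (Nq p q u)]⟩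
  have hSn : S.Nonempty := ⟨_, u0, hu0, hu0ne, rfl⟩
  set J := sInf S with hJdef
  have hJ : ∀ w, PeriodicC1 w → w ≠ 0 → J ≤ Iq p q w - H (Nq p q w) := fun w hw hw0 =>
    csInf_le hSb ⟨w, hw, hw0, rfl⟩
  have hJneg : J < 0 := lt_of_le_of_lt (hJ u0 hu0 hu0ne) (by linarith)
  -- minimizing sequence
  have hseq : ∀ n : ℕ, ∃ v, PeriodicC1 v ∧ (∀ x, 0 ≤ v x) ∧ av (fun x => |v x| ^ q) = 1 ∧
      Iq p q v - H (Nq p q v) < J + 1 / ((n:ℝ) + 1) := by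
    intro n
    have hpos : (0:ℝ) < 1 / ((n:ℝ) + 1) := by positivity
    obtain ⟨y, ⟨u, hu, hune, rfl⟩, hy⟩ := exists_lt_of_csInf_lt hSn
      (show sInf S < J + (1 / ((n:ℝ) + 1)) / 2 by rw [← hJdef]; linarith)
    obtain ⟨v, h1, h2, h3, h4⟩ := smoothing hp hq1 cH hu hune (half_pos hpos)
    exact ⟨v, h1, h2, h3, by linarith⟩
  choose v hv hv0 hvQ hvF using hseq
  have hvne : ∀ n, v n ≠ 0 := by
    intro n h
    have := hvQ n
    simp only [h, Pi.zero_apply, abs_zero] at this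
    rw [zero_rpow (by linarith), av_const] at this
    exact zero_ne_one this
  have hIv : ∀ n, Iq p q (v n) = av (fun x => |deriv (v n) x| ^ p) ^ (2 / p) := by
    intro n; unfold Iq; rw [hvQ n, one_rpow, mul_one]
  have hNv : ∀ n, Nq p q (v n) = av (fun x => |v n x| ^ p) ^ (2 / p) := by
    intro n; unfold Nq; rw [hvQ n, one_rpow, mul_one]
  have hKnn : ∀ n, 0 ≤ av (fun x => |deriv (v n) x| ^ p) := fun n => av_nonneg fun x => by positivity
  have hpinv : ∀ a : ℝ, 0 ≤ a → (a ^ (2 / p)) ^ (p / 2) = a := by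
    intro a ha
    rw [← rpow_mul ha]
    have : 2 / p * (p / 2) = 1 := by field_simp
    rw [this, rpow_one]
  have hpinv' : ∀ a : ℝ, 0 ≤ a → (a ^ (p / 2)) ^ (2 / p) = a := by
    intro a ha
    rw [← rpow_mul ha]
    have : p / 2 * (2 / p) = 1 := by field_simp
    rw [this, rpow_one]
  have hKb : ∀ n, av (fun x => |deriv (v n) x| ^ p) ≤ (B + 1) ^ (p / 2) := by
    intro n
    rw [← hpinv _ (hKnn n)]
    apply rpow_le_rpow (rpow_nonneg (hKnn n) _) _ (by positivity)
    rw [← hIv]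
    have h1 := hvF n
    have h2 : 1 / ((n:ℝ) + 1) ≤ 1 := by
      rw [div_le_one (by positivity)]
      have : (0:ℝ) ≤ n := n.cast_nonneg
      linarith
    linarith [hB (Nq p q (v n))]
  obtain ⟨φ, hφ, u, cu, pu, hlim⟩ := compactness hp hq1 hv hv0 hvQ hKb
  have hcv := fun n => (hv (φ n)).2.continuous
  have pt : ∀ y, Filter.Tendsto (fun n => v (φ n) y) Filter.atTop (nhds (u y)) := by
    intro y
    rw [Metric.tendsto_nhds]
    intro ε hε
    filter_upwards [hlim ε hε] with n hn
    rw [Real.dist_eq]; exact hn y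
  have u_nn : ∀ x, 0 ≤ u x := fun x => ge_of_tendsto' (pt x) (fun n => hv0 _ x)
  have cΦ : ∀ r : ℝ, 0 ≤ r → Continuous (Function.uncurry fun _ y : ℝ => |y| ^ r) := by
    intro r hr
    exact (continuous_snd.abs).rpow_const (fun _ => Or.inr hr)
  have TQ := unif_tendsto hcv cu hlim (cΦ q (by linarith))
  simp only [hvQ] at TQ
  have hQ : av (fun x => |u x| ^ q) = 1 := tendsto_nhds_unique TQ tendsto_const_nhds
  have une : u ≠ 0 := by
    intro h
    simp only [h, Pi.zero_apply, abs_zero] at hQ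
    rw [zero_rpow (by linarith), av_const] at hQ
    exact zero_ne_one hQ
  have hP : 0 < av (fun x => |u x| ^ p) := av_abs_pos cu pu une (by linarith)
  have TP := unif_tendsto hcv cu hlim (cΦ p (by linarith))
  have TN := TP.rpow_const (p := 2 / p) (Or.inr (by positivity))
  have TH := (cH.tendsto _).comp TN
  have TF : Filter.Tendsto (fun n => Iq p q (v n) - H (Nq p q (v n))) Filter.atTop (nhds J) := by
    refine tendsto_of_tendsto_of_tendsto_of_le_of_le tendsto_const_nhds
      (?_ : Filter.Tendsto (fun n : ℕ => J + 1 / ((n:ℝ) + 1)) Filter.atTop (nhds J)) 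
      (fun n => hJ _ (hv n) (hvne n)) (fun n => (hvF n).le)
    simpa using (tendsto_one_div_add_atTop_nhds_zero_nat (𝕜 := ℝ)).const_add J
  have TF' := TF.comp hφ.tendsto_atTop
  set N := av (fun x => |u x| ^ p) ^ (2 / p) with hN
  have TI : Filter.Tendsto (fun n => av (fun x => |deriv (v (φ n)) x| ^ p) ^ (2 / p)) Filter.atTop
      (nhds (J + H N)) := by
    refine (TF'.add TH).congr (fun n => ?_)
    simp only [Function.comp, hIv, hNv]
    ring
  have hI0 : 0 ≤ J + H N := ge_of_tendsto' TI fun n => rpow_nonneg (hKnn _) _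
  have TK : Filter.Tendsto (fun n => av (fun x => |deriv (v (φ n)) x| ^ p)) Filter.atTop
      (nhds ((J + H N) ^ (p / 2))) := by
    refine (TI.rpow_const (p := p / 2) (Or.inr (by positivity))).congr (fun n => ?_)
    exact hpinv _ (hKnn _)
  set K := (J + H N) ^ (p / 2) with hK
  have hK2 : K ^ (2 / p) = J + H N := hpinv' _ hI0
  have hKpos : 0 < K := by
    have : 0 ≤ K := rpow_nonneg hI0 _
    refine lt_of_le_of_ne this (fun h => ?_)
    rw [← h] at TK
    have hc := const_of_tendsto hp pu (fun n => hv (φ n)) hlim TK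
    have hu1 : u 0 = 1 := by
      simp only [hc] at hQ
      rw [av_const, abs_of_nonneg (u_nn 0)] at hQ
      have hq0 : q ≠ 0 := by linarith
      rw [← one_rpow q] at hQ
      exact (Real.rpow_left_inj (u_nn 0) zero_le_one hq0).1 hQ
    have hN1 : N = 1 := by
      rw [hN]; simp only [hc, hu1, abs_one, one_rpow, av_const]
    rw [← h, hN1, zero_rpow (by positivity)] at hK2
    linarith
  have hvar : ∀ w, PeriodicC1 w → _ := fun w hw =>
    first_variation (K := K) hp hq1 (H := H) cu hw.2.continuous u_nn hP hQ hKpos (hH N) (by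
      have := hmin_of_min (K := K) hp hq1 cH hJ (fun n => hv (φ n)) cu hlim hQ TK hw rfl
      have e : K ^ (2 / p) - H N = J := by rw [hK2]; ring
      rw [← hN, e]
      exact this)
  set P := av (fun x => |u x| ^ p) with hPdef
  set h := k N * P ^ (2 / p - 1) * K ^ (1 - 2 / p) with hh
  set β := k N * N * K ^ (1 - 2 / p) - K with hβ
  obtain ⟨huC, huK, huw⟩ := regularity hp cu pu
    (f := fun x => h * u x ^ (p - 1) - β * u x ^ (q - 1))
    ((continuous_const.fun_mul (cu.rpow_const fun _ => Or.inr (by linarith))).fun_sub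
      (continuous_const.fun_mul (cu.rpow_const fun _ => Or.inr (by linarith))))
    (fun x => by simp only [pu x]) (fun n => hv (φ n)) hlim TK hvar
  have hP' : P = av (fun x => u x ^ p) := by
    rw [hPdef]; congr 1; ext x; rw [abs_of_nonneg (u_nn x)]
  have fin := cdc hp hq hpq huC u_nn huw (by
    have h1 : (p - q) * h = ((p - q) * k N) * (P ^ (2 / p - 1) * K ^ (1 - 2 / p)) := by
      rw [hh]; ring
    rw [h1]
    exact mul_nonneg (hk N) (by positivity)) (by rw [huK]; exact hKpos) (by rw [← hP']; exact hP)
  rw [huK, ← hP'] at fin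
  have hc := cond u huC u_nn hQ (by rw [huK]; exact hKpos)
  have hIu : Iq p q u = K ^ (2 / p) := by unfold Iq; rw [hQ, one_rpow, mul_one, huK]
  have hNu : Nq p q u = N := by unfold Nq; rw [hQ, one_rpow, mul_one]
  rw [hIu, hNu] at hc
  have X : 0 < P ^ (2 / p - 1) * K ^ (2 - 2 / p) := by positivity
  have hmul := mul_lt_mul_of_pos_right hc X
  have hN0 : 0 < N := by positivity
  have e1 : K ^ (1 - 2 / p) * K = K ^ (2 - 2 / p) := by
    nth_rw 2 [← rpow_one K]
    rw [← rpow_add hKpos]; congr 1; ring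
  have e2 : K ^ (2 / p) / N * (P ^ (2 / p - 1) * K ^ (2 - 2 / p)) = K ^ 2 / P := by
    have a1 : K ^ (2 / p) * K ^ (2 - 2 / p) = K ^ 2 := by
      rw [← rpow_add hKpos, ← rpow_natCast]; congr 1; push_cast; ring
    have a2 : P ^ (2 / p - 1) = N / P := by
      rw [rpow_sub hP, rpow_one]
    rw [a2, ← a1]
    field_simp
  rw [add_mul, mul_assoc _ (K ^ (2 / p) / N), e2] at hmul
  have e3 : h * (p - q) * K = (p - q) * k N * (P ^ (2 / p - 1) * K ^ (2 - 2 / p)) := by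
    rw [hh, ← e1]; ring
  rw [e3] at fin
  linarith

lemma av_shift {f : ℝ → ℝ} (pf : Function.Periodic f (2 * π)) (a : ℝ) :
    av (fun x => f (a + x)) = av f := by
  unfold av
  congr 1
  rw [intervalIntegral.integral_comp_add_left (fun x => f x), add_zero,
    pf.intervalIntegral_add_eq a 0, zero_add]

lemma av_sq_lin : av (fun x => (x - π) ^ 2) = π ^ 2 / 3 := by
  unfold av
  rw [intervalIntegral.integral_comp_sub_right (fun x => x ^ 2), integral_pow]
  have := pi_pos
  field_simp
  push_cast
  ring

lemma sup_bound {p q : ℝ} (hp : 2 < p) (hq : 1 < q) {u : ℝ → ℝ} (hu : PeriodicC1 u)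
    (hu0 : ∀ x, 0 ≤ u x) (hQ : av (fun x => |u x| ^ q) = 1) (x : ℝ) :
    u x ≤ 1 + √(π ^ 2 / 3 * Iq p q u) := by
  have cu := hu.2.continuous
  have cD := hu.cont_deriv
  have hI : Iq p q u = av (fun x => |deriv u x| ^ p) ^ (2 / p) := by
    unfold Iq; rw [hQ, one_rpow, mul_one]
  have hav : av u ≤ 1 := by
    have := av_power_mean one_pos hq.le cu
    rw [hQ, one_rpow] at this
    simp only [rpow_one, div_one, abs_of_nonneg (hu0 _)] at this
    exact this
  have hid : av (fun t => (t - π) * deriv u (x + t)) = u x - av u := by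
    have h1 := intervalIntegral.integral_mul_deriv_eq_deriv_mul (a := 0) (b := 2 * π)
      (u := fun t => t - π) (u' := fun _ => 1) (v := fun t => u (x + t))
      (v' := fun t => deriv u (x + t))
      (fun t _ => (hasDerivAt_id t).sub_const π)
      (fun t _ => (hu.diff (x + t)).comp_const_add x t)
      (continuous_const.intervalIntegrable _ _)
      ((cD.comp (continuous_const.add continuous_id)).intervalIntegrable _ _)
    have h2 := av_shift hu.1 x
    unfold av at h2
    unfold av
    rw [← h2, h1]
    have hper : u (x + 2 * π) = u x := hu.1 x
    simp only [one_mul, add_zero, hper]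
    have := pi_pos
    field_simp
    ring
  have cs := av_cs (f := fun t => t - π) (g := fun t => deriv u (x + t)) (by fun_prop)
    (cD.comp (continuous_const.add continuous_id))
  rw [hid, av_sq_lin] at cs
  have hsh : av (fun t => deriv u (x + t) ^ 2) = av (fun t => deriv u t ^ 2) :=
    av_shift (f := fun t => deriv u t ^ 2) (fun t => by simp only [hu.per_deriv t]) x
  rw [hsh] at cs
  have hpm := av_power_mean (by norm_num : (0:ℝ) < 2) hp.le cD
  have e2 : (fun t => |deriv u t| ^ (2:ℝ)) = fun t => deriv u t ^ 2 := by
    ext t; rw [rpow_two, sq_abs]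
  rw [e2] at hpm
  have h0 : 0 ≤ av (fun t => deriv u t ^ 2) := av_nonneg fun t => sq_nonneg _
  have hK0 : 0 ≤ av (fun x => |deriv u x| ^ p) := av_nonneg fun x => by positivity
  have hle : av (fun t => deriv u t ^ 2) ≤ Iq p q u := by
    have h3 := rpow_le_rpow (by positivity) hpm (by norm_num : (0:ℝ) ≤ 2)
    rw [← rpow_mul h0, ← rpow_mul hK0] at h3
    have a1 : (1:ℝ) / 2 * 2 = 1 := by norm_num
    have a2 : 1 / p * 2 = 2 / p := by ring
    rw [a1, a2, rpow_one] at h3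
    rw [hI]; exact h3
  have : u x - av u ≤ √(π ^ 2 / 3 * Iq p q u) := by
    apply Real.le_sqrt_of_sq_le
    refine cs.trans ?_
    gcongr
  linarith

lemma sup_lower {p q M z : ℝ} (hp : 2 < p) (hq : p - 1 < q) (hpq : q ≠ p) {u : ℝ → ℝ}
    (cu : Continuous u) (hu0 : ∀ x, 0 ≤ u x) (hQ : av (fun x => |u x| ^ q) = 1)
    (hM : 0 < M) (hle : ∀ x, u x ≤ M) (hz : 0 ≤ z)
    (hN : Nq p q u = 1 + (p - q) * z) : (1 + z) ^ (p / 2) ≤ M := by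
  have hNP : Nq p q u = av (fun x => |u x| ^ p) ^ (2 / p) := by
    unfold Nq; rw [hQ, one_rpow, mul_one]
  have hP0 : 0 ≤ av (fun x => |u x| ^ p) := av_nonneg fun x => by positivity
  rw [hNP] at hN
  have cp := cont_abs_rpow cu (by linarith : 0 ≤ p)
  have cq := cont_abs_rpow cu (by linarith : 0 ≤ q)
  have hz1 : 0 < 1 + z := by linarith
  have hM2 : 0 < M ^ (2 / p) := by positivity
  have hMd : (M ^ (p - q)) ^ (2 / p) = (M ^ (2 / p)) ^ (p - q) := by
    rw [← rpow_mul hM.le, ← rpow_mul hM.le, mul_comm]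
  have hfac : ∀ x, 0 < u x → |u x| ^ p = |u x| ^ (p - q) * |u x| ^ q := by
    intro x hx
    rw [abs_of_pos hx, ← rpow_add hx]; congr 1; ring
  have hzero : ∀ x, u x = 0 → |u x| ^ p = 0 ∧ |u x| ^ q = 0 := by
    intro x hx
    rw [hx, abs_zero, zero_rpow (by linarith), zero_rpow (by linarith)]; simp
  have hq0 : ∀ x, 0 ≤ |u x| ^ q := fun x => by positivity
  have fin : 1 + z ≤ M ^ (2 / p) := by
    rcases lt_or_gt_of_ne hpq with hlt | hgt
    · have h1 : av (fun x => |u x| ^ p) ≤ M ^ (p - q) := by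
        have : av (fun x => |u x| ^ p) ≤ av (fun x => M ^ (p - q) * |u x| ^ q) := by
          apply av_mono cp (continuous_const.fun_mul cq)
          intro x
          rcases (hu0 x).eq_or_lt with h | h
          · rw [(hzero x h.symm).1, (hzero x h.symm).2, mul_zero]
          · rw [hfac x h]
            apply mul_le_mul_of_nonneg_right _ (hq0 x)
            apply rpow_le_rpow (abs_nonneg _) _ (by linarith)
            rw [abs_of_pos h]; exact hle x
        rwa [av_cmul, hQ, mul_one] at this
      have h2 : av (fun x => |u x| ^ p) ^ (2 / p) ≤ (M ^ (2 / p)) ^ (p - q) := by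
        rw [← hMd]; exact rpow_le_rpow hP0 h1 (by positivity)
      rw [hN] at h2
      have h3 := rpow_one_add_le_one_add_mul_self (by linarith : (-1:ℝ) ≤ z)
        (by linarith : 0 ≤ p - q) (by linarith : p - q ≤ 1)
      exact (rpow_le_rpow_iff hz1.le hM2.le (by linarith : 0 < p - q)).1 (h3.trans h2)
    · have h1 : M ^ (p - q) ≤ av (fun x => |u x| ^ p) := by
        have : av (fun x => M ^ (p - q) * |u x| ^ q) ≤ av (fun x => |u x| ^ p) := by
          apply av_mono (continuous_const.fun_mul cq) cp
          intro x
          rcases (hu0 x).eq_or_lt with h | h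
          · rw [(hzero x h.symm).1, (hzero x h.symm).2, mul_zero]
          · rw [hfac x h]
            apply mul_le_mul_of_nonneg_right _ (hq0 x)
            rw [abs_of_pos h]
            exact rpow_le_rpow_of_nonpos h (hle x) (by linarith)
        rwa [av_cmul, hQ, mul_one] at this
      have h2 : (M ^ (2 / p)) ^ (p - q) ≤ av (fun x => |u x| ^ p) ^ (2 / p) := by
        rw [← hMd]; exact rpow_le_rpow (by positivity) h1 (by positivity)
      rw [hN] at h2
      have h3 : 1 + (p - q) * z ≤ (1 + z) ^ (p - q) := by
        rw [rpow_def_of_pos hz1]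
        have a1 := add_one_le_exp (log (1 + z) * (p - q))
        have a2 := log_le_sub_one_of_pos hz1
        nlinarith
      have h4 := h2.trans h3
      by_contra hcon
      push Not at hcon
      have := rpow_lt_rpow_of_neg hM2 hcon (by linarith : p - q < 0)
      linarith
  have := rpow_le_rpow hz1.le fin (by positivity : 0 ≤ p / 2)
  rw [← rpow_mul hM.le] at this
  have e : 2 / p * (p / 2) = 1 := by field_simp
  rwa [e, rpow_one] at this

lemma numeric {p w I : ℝ} (hp : 2 < p) (hw : 0 ≤ w) (hI : 0 < I) (hwI : w ≤ I)
    (h : (1 + w) ^ (p / 2) ≤ 1 + √(π ^ 2 / 3 * I)) : w ^ (p - 1) / 2 < I := by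
  rcases hw.eq_or_lt with h0 | h0
  · rw [← h0, zero_rpow (by linarith)]; linarith
  have e : w ^ (p - 1) = w ^ (p - 2) * w := by
    nth_rw 3 [← rpow_one w]
    rw [← rpow_add h0]; congr 1; ring
  rcases lt_or_ge (w ^ (p - 2)) 2 with h2 | h2
  · rw [e]; nlinarith
  have w1 : 1 < w := by
    by_contra hc
    push Not at hc
    have := rpow_le_one hw hc (by linarith : 0 ≤ p - 2)
    linarith
  set a := p / 2 - 1 with ha
  have ha0 : 0 < a := by linarith
  have hpa : p - 2 = 2 * a := by rw [ha]; ring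
  have hwa : 1 ≤ w ^ a := one_le_rpow w1.le ha0.le
  have b1 : w ^ a * (w + a) ≤ (1 + w) ^ (p / 2) - 1 := by
    have c1 := one_add_mul_self_le_rpow_one_add (s := 1 / w) (by have : 0 < 1 / w := by positivity
                                                                 linarith)
      (by linarith : 1 ≤ p / 2)
    have c2 : (1 + w) ^ (p / 2) = w ^ (p / 2) * (1 + 1 / w) ^ (p / 2) := by
      rw [← mul_rpow hw (by positivity)]
      congr 1
      field_simp
      ring
    have c3 : w ^ (p / 2) = w ^ a * w := by
      nth_rw 3 [← rpow_one w]
      rw [← rpow_add h0]; congr 1; rw [ha]; ring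
    have c4 : w ^ (p / 2) * (1 + p / 2 * (1 / w)) = w ^ a * (w + p / 2) := by
      rw [c3]; field_simp
    have c5 : w ^ (p / 2) * (1 + p / 2 * (1 / w)) ≤ (1 + w) ^ (p / 2) := by
      rw [c2]
      exact mul_le_mul_of_nonneg_left c1 (by positivity)
    rw [c4] at c5
    have : p / 2 = a + 1 := by rw [ha]; ring
    nlinarith
  have b2 : w ^ a * (w + a) ≤ √(π ^ 2 / 3 * I) := by linarith
  have b3 : (w ^ a * (w + a)) ^ 2 ≤ π ^ 2 / 3 * I := by
    have := pow_le_pow_left₀ (by positivity) b2 2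
    rwa [sq_sqrt (by positivity)] at this
  have hpi2 : π ^ 2 < 9.9 := by
    have := pi_lt_d4
    have := pi_pos
    nlinarith
  have b4 : π ^ 2 / 6 * w < (w + a) ^ 2 := by
    rcases le_or_gt 0.42 a with h42 | h42
    · nlinarith [sq_nonneg (w - a)]
    · have w2 : 2 < w := by
        have : w ^ (p - 2) < w ^ (1:ℝ) := rpow_lt_rpow_of_exponent_lt w1 (by rw [hpa]; linarith)
        rw [rpow_one] at this
        linarith
      nlinarith
  have b5 : (w ^ a) ^ 2 = w ^ (p - 2) := by
    rw [← rpow_mul_natCast hw, hpa]; congr 1; push_cast; ring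
  rw [mul_pow, b5] at b3
  have b6 : w ^ (p - 2) * (π ^ 2 / 6 * w) < w ^ (p - 2) * (w + a) ^ 2 :=
    mul_lt_mul_of_pos_left b4 (by positivity)
  rw [e]
  have hpp : 0 < π ^ 2 := by have := pi_pos; positivity
  nlinarith

lemma key_bound {p q w z : ℝ} (hp : 2 < p) (hq : p - 1 < q) (hpq : q ≠ p) {u : ℝ → ℝ}
    (hu : PeriodicC1 u) (hu0 : ∀ x, 0 ≤ u x) (hQ : av (fun x => |u x| ^ q) = 1)
    (hK : 0 < av (fun x => |deriv u x| ^ p)) (hw : 0 ≤ w) (hwz : w ≤ z)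
    (hN : Nq p q u = 1 + (p - q) * z) (hwI : w ≤ Iq p q u) : w ^ (p - 1) / 2 < Iq p q u := by
  have hI : 0 < Iq p q u := by
    unfold Iq; rw [hQ, one_rpow, mul_one]; positivity
  refine numeric hp hw hI hwI ?_
  refine le_trans ?_ (sup_lower hp hq hpq hu.2.continuous hu0 hQ (by positivity)
    (sup_bound hp (by linarith) hu hu0 hQ) (hw.trans hwz) hN)
  exact rpow_le_rpow (by linarith) (by linarith) (by linarith)

lemma Nq_pos {p q : ℝ} (hp : 0 < p) (hq : 0 < q) {u : ℝ → ℝ} (hu : PeriodicC1 u) (hu0 : u ≠ 0) :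
    0 < Nq p q u := by
  have h1 := av_abs_pos hu.2.continuous hu.1 hu0 hp
  have h2 := av_abs_pos hu.2.continuous hu.1 hu0 hq
  unfold Nq; positivity

lemma zq_nonneg {p q : ℝ} (hp : 0 < p) (hq : 0 < q) (hpq : q ≠ p) {u : ℝ → ℝ}
    (hu : PeriodicC1 u) (hu0 : u ≠ 0) : 0 ≤ (Nq p q u - 1) / (p - q) := by
  have h1 := av_abs_pos hu.2.continuous hu.1 hu0 hp
  have h2 := av_abs_pos hu.2.continuous hu.1 hu0 hq
  have e : ∀ r : ℝ, ∀ a : ℝ, 0 < a → a ^ (2 / r) = (a ^ (1 / r)) ^ (2:ℝ) := by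
    intro r a ha
    rw [← rpow_mul ha.le]; congr 1; ring
  have e2 : Nq p q u = av (fun x => |u x| ^ p) ^ (2 / p) / av (fun x => |u x| ^ q) ^ (2 / q) := by
    unfold Nq; rw [rpow_neg h2.le]; rfl
  have h3 : 0 < av (fun x => |u x| ^ q) ^ (2 / q) := by positivity
  rcases lt_or_gt_of_ne hpq with h | h
  · have h4 := av_power_mean hq h.le hu.2.continuous
    have h5 : av (fun x => |u x| ^ q) ^ (2 / q) ≤ av (fun x => |u x| ^ p) ^ (2 / p) := by
      rw [e _ _ h1, e _ _ h2]
      exact rpow_le_rpow (by positivity) h4 (by norm_num)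
    apply div_nonneg _ (by linarith)
    rw [e2, sub_nonneg, le_div_iff₀ h3]; linarith
  · have h4 := av_power_mean hp h.le hu.2.continuous
    have h5 : av (fun x => |u x| ^ p) ^ (2 / p) ≤ av (fun x => |u x| ^ q) ^ (2 / q) := by
      rw [e _ _ h1, e _ _ h2]
      exact rpow_le_rpow (by positivity) h4 (by norm_num)
    apply div_nonneg_of_nonpos _ (by linarith)
    rw [e2, sub_nonpos, div_le_iff₀ h3]; linarith

lemma ne_zero_of_av {q : ℝ} (hq : 0 < q) {u : ℝ → ℝ} (h : av (fun x => |u x| ^ q) = 1) : u ≠ 0 := by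
  rintro rfl
  have : av (fun x => |(0 : ℝ → ℝ) x| ^ q) = 0 := by
    simp [av, zero_rpow hq.ne']
  rw [this] at h
  exact zero_ne_one h

lemma core {p q z0 : ℝ} (hp : 2 < p) (hq : p - 1 < q) (hpq : q ≠ p) (hz0 : 0 ≤ z0) {φ : ℝ → ℝ}
    (hφ : ContinuousOn φ (Set.Icc 0 z0)) (hφ0 : ∀ t ∈ Set.Icc 0 z0, 0 ≤ φ t)
    (cond : ∀ u, PeriodicC1 u → (∀ x, 0 ≤ u x) → av (fun x => |u x| ^ q) = 1 →
      0 < av (fun x => |deriv u x| ^ p) → ∀ t, 0 ≤ t → t ≤ (Nq p q u - 1) / (p - q) →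
      t ≤ z0 → φ t < lambdaOne p + (p - 1) ^ 2 / (2 * p - 1) * (1 + q - p) *
        (Iq p q u / Nq p q u))
    {u : ℝ → ℝ} (hu : PeriodicC1 u) (hu0 : u ≠ 0) (hz : (Nq p q u - 1) / (p - q) = z0) :
    ∫ t in (0:ℝ)..z0, φ t ≤ Iq p q u := by
  have hpq' : p - q ≠ 0 := sub_ne_zero.2 hpq.symm
  set σ : ℝ → ℝ := fun s => max 0 (min z0 s) with hσ
  have cσ : Continuous σ := by fun_prop
  have mσ : ∀ s, σ s ∈ Set.Icc 0 z0 := fun s =>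
    ⟨le_max_left _ _, max_le hz0 (min_le_left _ _)⟩
  set f : ℝ → ℝ := fun s => φ (σ s) * max 0 (1 - |s - σ s|) with hf
  have cf : Continuous f := by
    refine (hφ.comp_continuous cσ mσ).fun_mul ?_
    fun_prop
  have f0 : ∀ s, 0 ≤ f s := fun s => mul_nonneg (hφ0 _ (mσ s)) (le_max_left _ _)
  have fle : ∀ s, f s ≤ φ (σ s) := fun s =>
    mul_le_of_le_one_right (hφ0 _ (mσ s)) (max_le zero_le_one (by linarith [abs_nonneg (s - σ s)]))
  have fi : Integrable f := by
    refine cf.integrable_of_hasCompactSupport (HasCompactSupport.intro (K := Set.Icc (-1) (z0 + 1)) isCompact_Icc ?_)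
    intro s hs
    have : max 0 (1 - |s - σ s|) = 0 := by
      apply max_eq_left
      have h1 := (mσ s).1
      have h2 := (mσ s).2
      rw [Set.mem_Icc, not_and_or, not_le, not_le] at hs
      rcases hs with h | h
      · rw [abs_of_neg (by linarith)]; linarith
      · rw [abs_of_pos (by linarith)]; linarith
    simp only [hf, this, mul_zero]
  have hF : ∀ s, HasDerivAt (fun s => ∫ t in (0:ℝ)..s, f t) (f s) s := fun s =>
    intervalIntegral.integral_hasDerivAt_right (cf.intervalIntegrable _ _)
      (cf.stronglyMeasurableAtFilter _ _) cf.continuousAt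
  have key := main_lemma hp hq hpq (H := fun n => ∫ t in (0:ℝ)..((n - 1) / (p - q)), f t)
    (k := fun n => f ((n - 1) / (p - q)) * (1 / (p - q))) (B := ∫ t, f t)
    (fun n => by
      have h1 : HasDerivAt (fun n : ℝ => (n - 1) / (p - q)) (1 / (p - q)) n :=
        ((hasDerivAt_id n).sub_const 1).div_const _
      exact (hF _).comp n h1)
    (fun n => by
      refine (Real.le_norm_self _).trans ?_
      refine (intervalIntegral.norm_integral_le_integral_norm_uIoc).trans ?_
      simp_rw [Real.norm_eq_abs, fun t => abs_of_nonneg (f0 t)]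
      exact setIntegral_le_integral fi (Filter.Eventually.of_forall f0))
    (by simp)
    (fun n => by
      have := f0 ((n - 1) / (p - q))
      field_simp
      exact this)
    (fun v hv hv0 hQ hK => by
      have hvne := ne_zero_of_av (by linarith) hQ
      have hzv := zq_nonneg (by linarith) (by linarith) hpq hv hvne
      have h1 : (p - q) * (f ((Nq p q v - 1) / (p - q)) * (1 / (p - q)))
          = f ((Nq p q v - 1) / (p - q)) := by field_simp
      simp only [h1]
      refine (fle _).trans_lt (cond v hv hv0 hQ hK _ (mσ _).1 ?_ (mσ _).2)
      exact max_le hzv (min_le_right _ _))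
    u hu hu0
  simp only [hz] at key
  refine le_trans (le_of_eq ?_) key
  apply intervalIntegral.integral_congr
  intro t ht
  rw [Set.uIcc_of_le hz0] at ht
  have : σ t = t := by
    simp only [hσ]; rw [min_eq_right ht.2, max_eq_right ht.1]
  simp [hf, this]

lemma step1 {p q : ℝ} (hp : 2 < p) (hq : p - 1 < q) (hpq : q ≠ p) {u : ℝ → ℝ}
    (hu : PeriodicC1 u) (hu0 : u ≠ 0) :
    lambdaOne p * ((Nq p q u - 1) / (p - q)) ≤ Iq p q u := by
  have h := core hp hq hpq (zq_nonneg (by linarith) (by linarith) hpq hu hu0)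
    (φ := fun _ => lambdaOne p) continuousOn_const (fun _ _ => lambda_nonneg p)
    (fun v hv hv0 hQ hK t _ _ _ => by
      have hI : 0 < Iq p q v := by
        unfold Iq; rw [hQ, one_rpow, mul_one]; positivity
      have hN := Nq_pos (p := p) (q := q) (by linarith) (by linarith) hv (ne_zero_of_av (by linarith) hQ)
      have h1 : 0 < 2 * p - 1 := by linarith
      have h2 : 0 < 1 + q - p := by linarith
      have h3 : 0 < p - 1 := by linarith
      have : 0 < (p - 1) ^ 2 / (2 * p - 1) * (1 + q - p) * (Iq p q v / Nq p q v) := by positivity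
      linarith) hu hu0 rfl
  simp only [intervalIntegral.integral_const, smul_eq_mul, sub_zero] at h
  linarith

lemma frac_mono {p d t z : ℝ} (hp : 2 < p) (ht : 0 ≤ t) (htz : t ≤ z) (hz : 0 < 1 + d * z) :
    0 < 1 + d * t ∧ t ^ (p - 1) / (1 + d * t) ≤ z ^ (p - 1) / (1 + d * z) := by
  have hz0 : 0 ≤ z := ht.trans htz
  have h1 : t ^ (p - 1) ≤ z ^ (p - 1) := rpow_le_rpow ht htz (by linarith)
  have h2 : 0 ≤ t ^ (p - 1) := by positivity
  rcases le_total 0 d with hd | hd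
  · have h3 : 0 < 1 + d * t := by positivity
    refine ⟨h3, ?_⟩
    rw [div_le_div_iff₀ h3 hz]
    have e : ∀ x : ℝ, 0 ≤ x → x ^ (p - 1) = x ^ (p - 2) * x := by
      intro x hx
      rw [← rpow_add_one' hx (by linarith)]; congr 1; ring
    have h4 : t ^ (p - 2) ≤ z ^ (p - 2) := rpow_le_rpow ht htz (by linarith)
    have h5 : t ^ (p - 1) * (d * z) ≤ z ^ (p - 1) * (d * t) := by
      rw [e t ht, e z hz0]
      have : 0 ≤ d * t * z := by positivity
      nlinarith
    nlinarith
  · have h4 : d * z ≤ d * t := mul_le_mul_of_nonpos_left htz hd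
    refine ⟨by linarith, ?_⟩
    exact div_le_div₀ (h2.trans h1) h1 hz (by linarith)

lemma step2 {p q : ℝ} (hp : 2 < p) (hq : p - 1 < q) (hpq : q ≠ p) {u : ℝ → ℝ}
    (hu : PeriodicC1 u) (hu0 : u ≠ 0) :
    lambdaOne p * ((Nq p q u - 1) / (p - q) + ((p - 1) ^ 2 / (2 * (2 * p - 1))) * (1 + q - p) *
      (lambdaOne p) ^ (p - 2) *
      ∫ s in (0:ℝ)..((Nq p q u - 1) / (p - q)), s ^ (p - 1) / (1 + (p - q) * s)) ≤ Iq p q u := by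
  have hpq' : p - q ≠ 0 := sub_ne_zero.2 hpq.symm
  have hz0 := zq_nonneg (p := p) (q := q) (by linarith) (by linarith) hpq hu hu0
  have hN0 := Nq_pos (p := p) (q := q) (by linarith) (by linarith) hu hu0
  have hNz : 0 < 1 + (p - q) * ((Nq p q u - 1) / (p - q)) := by
    rw [mul_div_cancel₀ _ hpq']; linarith
  set z0 := (Nq p q u - 1) / (p - q) with hz0def
  have hl := lambda_nonneg p
  have hl1 := lambda_le_one p hp
  set l := lambdaOne p with hldef
  have h1 : 0 < 2 * p - 1 := by linarith
  have h2 : 0 < 1 + q - p := by linarith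
  have h3 : 0 < p - 1 := by linarith
  set C := ((p - 1) ^ 2 / (2 * (2 * p - 1))) * (1 + q - p) with hC
  have hCpos : 0 < C := by positivity
  have hC2 : (p - 1) ^ 2 / (2 * p - 1) * (1 + q - p) = 2 * C := by rw [hC]; field_simp
  have hll : l * l ^ (p - 2) = l ^ (p - 1) := by
    rw [mul_comm, ← rpow_add_one' hl (by linarith)]; congr 1; ring
  have cg : ContinuousOn (fun s : ℝ => s ^ (p - 1) / (1 + (p - q) * s)) (Set.Icc 0 z0) := by
    refine ContinuousOn.div ?_ (by fun_prop) ?_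
    · exact (continuous_id.rpow_const (fun _ => Or.inr h3.le)).continuousOn
    · intro s hs
      exact (frac_mono hp hs.1 hs.2 hNz).1.ne'
  have h := core hp hq hpq hz0
    (φ := fun s => l + C * l ^ (p - 1) * (s ^ (p - 1) / (1 + (p - q) * s)))
    (continuousOn_const.add (continuousOn_const.mul cg))
    (fun t ht => by
      have := (frac_mono hp ht.1 ht.2 hNz).1
      have := ht.1
      positivity)
    (fun v hv hv0 hQ hK t ht htv _ => by
      have hvne := ne_zero_of_av (by linarith) hQ
      have hN := Nq_pos (p := p) (q := q) (by linarith) (by linarith) hv hvne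
      have hzv := zq_nonneg (p := p) (q := q) (by linarith) (by linarith) hpq hv hvne
      have hs1 := step1 hp hq hpq hv hvne
      have hNv : 1 + (p - q) * ((Nq p q v - 1) / (p - q)) = Nq p q v := by
        rw [mul_div_cancel₀ _ hpq']; ring
      rw [← hldef] at hs1
      have kb := key_bound hp hq hpq hv hv0 hQ hK (mul_nonneg hl hzv)
        (mul_le_of_le_one_left hzv hl1) hNv.symm hs1
      rw [mul_rpow hl hzv] at kb
      have fm := (frac_mono (d := p - q) hp ht htv (by rw [hNv]; exact hN)).2
      rw [hNv] at fm
      rw [hC2]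
      have h5 : 0 ≤ C * l ^ (p - 1) := by positivity
      have h6 := mul_le_mul_of_nonneg_left fm h5
      have h7 : C * l ^ (p - 1) * (((Nq p q v - 1) / (p - q)) ^ (p - 1) / Nq p q v)
          < 2 * C * (Iq p q v / Nq p q v) := by
        rw [← mul_div_assoc, ← mul_div_assoc]
        apply div_lt_div_of_pos_right _ hN
        nlinarith
      linarith) hu hu0 rfl
  have gi : IntervalIntegrable (fun s : ℝ => s ^ (p - 1) / (1 + (p - q) * s)) volume 0 z0 := by
    apply ContinuousOn.intervalIntegrable
    rw [Set.uIcc_of_le hz0]; exact cg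
  rw [intervalIntegral.integral_add (by simp) (gi.const_mul _),
    intervalIntegral.integral_const_mul] at h
  simp only [intervalIntegral.integral_const, smul_eq_mul, sub_zero] at h
  rw [← hll] at h
  linarith

theorem improved_interp (p q : ℝ) (hp : 2 < p) (hq : p - 1 < q) (hpq : q ≠ p)
    (Ψ : ℝ → ℝ)
    (hΨ : ∀ z : ℝ, Ψ z = z + ((p - 1) ^ 2 / (2 * (2 * p - 1))) * (1 + q - p) *
      (lambdaOne p) ^ (p - 2) * ∫ s in (0:ℝ)..z, s ^ (p - 1) / (1 + (p - q) * s))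
    (u : ℝ → ℝ) (hu : PeriodicC1 u) (hu0 : u ≠ 0) :
    (perNorm p (deriv u)) ^ 2 ≥
      lambdaOne p * (perNorm q u) ^ 2 *
        Ψ (((perNorm p u) ^ 2 - (perNorm q u) ^ 2) / ((p - q) * (perNorm q u) ^ 2)) := by
  have hpq' : p - q ≠ 0 := sub_ne_zero.2 hpq.symm
  have hQ := av_abs_pos hu.2.continuous hu.1 hu0 (by linarith : 0 < q)
  have h := step2 hp hq hpq hu hu0
  rw [← hΨ] at h
  have hS : 0 < perNorm q u ^ 2 := by rw [perNorm_sq]; positivity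
  have eN : Nq p q u = perNorm p u ^ 2 / perNorm q u ^ 2 := by
    unfold Nq; rw [perNorm_sq, perNorm_sq, rpow_neg hQ.le]; rfl
  have eI : Iq p q u = perNorm p (deriv u) ^ 2 / perNorm q u ^ 2 := by
    unfold Iq; rw [perNorm_sq, perNorm_sq, rpow_neg hQ.le]; rfl
  have ez : (Nq p q u - 1) / (p - q)
      = ((perNorm p u) ^ 2 - (perNorm q u) ^ 2) / ((p - q) * (perNorm q u) ^ 2) := by
    rw [eN, div_sub_one hS.ne', div_div, mul_comm (p - q)]
  rw [ez, eI, le_div_iff₀ hS] at h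
  linarith
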